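/- Let v be a (2,1,1,1)-vertex in a smallest counterexample G. If v is not contained in any 5-cycle, then v has at most two friends that are (1,1,1)-vertices not contained in any 5-cycle. -/

import Mathlib

open SimpleGraph

/-- The degree of a vertex, as the cardinality of its neighbor set. -/
noncomputable def deg {V : Type} (G : SimpleGraph V) (v : V) : ℕ :=
  (G.neighborSet v).ncard

/-- The potential of a finite graph: `5 n(G) - 4 e(G)`. -/
noncomputable def pot {V : Type} [Fintype V] (G : SimpleGraph V) : ℤ :=
  5 * (Fintype.card V : ℤ) - 4 * (G.edgeSet.ncard : ℤ)

/-- A graph is 5/2-critical if it has no homomorphism to the 5-cycle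
but every proper subgraph has one. -/
def Critical52 {V : Type} (G : SimpleGraph V) : Prop :=
  IsEmpty (G →g cycleGraph 5) ∧
  ∀ H : G.Subgraph, H ≠ ⊤ → Nonempty (H.coe →g cycleGraph 5)

/-- The exceptional graph `E₁`: a 9-cycle `0 1 2 3 4 5 6 7 8` together
with a vertex `9` adjacent to `0`, `3` and `6`. -/
def E1 : SimpleGraph (Fin 10) := SimpleGraph.fromEdgeSet
  {s(0,1), s(1,2), s(2,3), s(3,4), s(4,5), s(5,6), s(6,7), s(7,8), s(8,0),
   s(9,0), s(9,3), s(9,6)}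

/-- The exceptional graph `E₂`: two 5-cycles `0 1 2 3 4` and `0 1 5 6 7`
sharing exactly the edge `01`, together with a path `3 8 9 6`. -/
def E2 : SimpleGraph (Fin 10) := SimpleGraph.fromEdgeSet
  {s(0,1), s(1,2), s(2,3), s(3,4), s(4,0),
   s(1,5), s(5,6), s(6,7), s(7,0),
   s(3,8), s(8,9), s(9,6)}

/-- A smallest counterexample: a 5/2-critical graph, not isomorphic to `C₃`, `E₁`, `E₂`,
with potential at least 2, such that every smaller 5/2-critical graph not isomorphic
to `C₃`, `E₁`, `E₂` has potential at most 1. -/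
def SmallestCex {V : Type} [Fintype V] (G : SimpleGraph V) : Prop :=
  Critical52 G ∧ IsEmpty (G ≃g cycleGraph 3) ∧ IsEmpty (G ≃g E1) ∧ IsEmpty (G ≃g E2) ∧
  2 ≤ pot G ∧
  ∀ (m : ℕ) (H : SimpleGraph (Fin m)), Critical52 H →
    IsEmpty (H ≃g cycleGraph 3) → IsEmpty (H ≃g E1) → IsEmpty (H ≃g E2) →
    m < Fintype.card V → pot H ≤ 1

/-- A string: a path of positive length whose endvertices have degree at least 3
and whose internal vertices have degree 2. A `k`-string is a string of length `k+1`. -/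
def IsString {V : Type} (G : SimpleGraph V) {u v : V} (p : G.Walk u v) : Prop :=
  p.IsPath ∧ 0 < p.length ∧ 3 ≤ deg G u ∧ 3 ≤ deg G v ∧
  ∀ w ∈ p.support, w ≠ u → w ≠ v → deg G w = 2

/-- `v` lies on a 5-cycle of `G`. -/
def InFiveCycle {V : Type} (G : SimpleGraph V) (v : V) : Prop :=
  ∃ (w : V) (c : G.Walk w w), c.IsCycle ∧ c.length = 5 ∧ v ∈ c.support

/-- `v` is a `(k₁,k₂,k₃)`-vertex: it has degree 3 and is the end of a `k₁`-string,
a `k₂`-string and a `k₃`-string leaving `v` through its three distinct edges. -/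
def IsVertex3 {V : Type} (G : SimpleGraph V) (v : V) (k1 k2 k3 : ℕ) : Prop :=
  deg G v = 3 ∧ ∃ (u1 u2 u3 : V) (p1 : G.Walk v u1) (p2 : G.Walk v u2) (p3 : G.Walk v u3),
    IsString G p1 ∧ IsString G p2 ∧ IsString G p3 ∧
    p1.getVert 1 ≠ p2.getVert 1 ∧ p1.getVert 1 ≠ p3.getVert 1 ∧ p2.getVert 1 ≠ p3.getVert 1 ∧
    p1.length = k1 + 1 ∧ p2.length = k2 + 1 ∧ p3.length = k3 + 1

/-- `v` is a `(k₁,k₂,k₃,k₄)`-vertex: it has degree 4 and is the end of strings of the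
corresponding lengths leaving `v` through its four distinct edges. -/
def IsVertex4 {V : Type} (G : SimpleGraph V) (v : V) (k1 k2 k3 k4 : ℕ) : Prop :=
  deg G v = 4 ∧ ∃ (u1 u2 u3 u4 : V) (p1 : G.Walk v u1) (p2 : G.Walk v u2)
    (p3 : G.Walk v u3) (p4 : G.Walk v u4),
    IsString G p1 ∧ IsString G p2 ∧ IsString G p3 ∧ IsString G p4 ∧
    p1.getVert 1 ≠ p2.getVert 1 ∧ p1.getVert 1 ≠ p3.getVert 1 ∧ p1.getVert 1 ≠ p4.getVert 1 ∧
    p2.getVert 1 ≠ p3.getVert 1 ∧ p2.getVert 1 ≠ p4.getVert 1 ∧ p3.getVert 1 ≠ p4.getVert 1 ∧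
    p1.length = k1 + 1 ∧ p2.length = k2 + 1 ∧ p3.length = k3 + 1 ∧ p4.length = k4 + 1

/-- `H` contains at least two distinct cycles, where cycles are counted as subgraphs,
i.e. two cycles are distinct if their edge sets differ. -/
def TwoDistinctCycles {V : Type} (H : SimpleGraph V) : Prop :=
  ∃ (v1 v2 : V) (c1 : H.Walk v1 v1) (c2 : H.Walk v2 v2),
    c1.IsCycle ∧ c2.IsCycle ∧ {e | e ∈ c1.edges} ≠ {e | e ∈ c2.edges}

/-- The degree of a 5-cycle (cell) `c` in `G`: the number of strings not contained in `c`
that intersect `c`, strings being counted by their edge sets. -/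
noncomputable def cellDegree {V : Type} (G : SimpleGraph V) {w : V} (c : G.Walk w w) : ℕ :=
  {S : Set (Sym2 V) | ∃ (u v : V) (p : G.Walk u v), IsString G p ∧ S = {e | e ∈ p.edges} ∧
    ¬ S ⊆ {e | e ∈ c.edges} ∧ ∃ x ∈ p.support, x ∈ c.support}.ncard

namespace Pf

/-- abbreviation for adjacency in the 5-cycle -/
abbrev c5 (a b : Fin 5) : Prop := (cycleGraph 5).Adj a b

/-- number of edges of the 5-cycle inside `A` -/
def e5 (A : Finset (Fin 5)) : ℕ := (Finset.univ.filter (fun k : Fin 5 => k ∈ A ∧ k + 1 ∈ A)).card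

lemma e5_bound : ∀ A : Finset (Fin 5), A.Nonempty →
    (5 + 4 * e5 A ≤ 5 * A.card ∧ (5 * A.card ≤ 5 + 4 * e5 A → A.card = 1 ∨ A.card = 5)) := by
  decide +kernel

open scoped Classical

/-- `φ` is a homomorphism to the 5-cycle on the set `S` -/
def PC {V : Type} (G : SimpleGraph V) (S : Finset V) (φ : V → Fin 5) : Prop :=
  ∀ a ∈ S, ∀ b ∈ S, G.Adj a b → c5 (φ a) (φ b)

/-- edges inside `S` -/
noncomputable def ES {V : Type} [Fintype V] (G : SimpleGraph V) (S : Finset V) : Finset (Sym2 V) :=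
  Finset.univ.filter (fun e => e ∈ G.edgeSet ∧ ∀ a ∈ e, a ∈ S)

/-- potential of the subgraph induced by `S` -/
noncomputable def pS {V : Type} [Fintype V] (G : SimpleGraph V) (S : Finset V) : ℤ :=
  5 * (S.card : ℤ) - 4 * ((ES G S).card : ℤ)

lemma mem_ES {V : Type} [Fintype V] (G : SimpleGraph V) (S : Finset V) (a b : V) :
    s(a, b) ∈ ES G S ↔ G.Adj a b ∧ a ∈ S ∧ b ∈ S := by
  simp [ES]

lemma ES_mono {V : Type} [Fintype V] (G : SimpleGraph V) {S T : Finset V} (h : S ⊆ T) :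
    ES G S ⊆ ES G T := by
  intro e he
  simp only [ES, Finset.mem_filter, Finset.mem_univ, true_and] at he ⊢
  exact ⟨he.1, fun a ha => h (he.2 a ha)⟩

lemma pot_eq {V : Type} [Fintype V] (G : SimpleGraph V) : pot G = pS G Finset.univ := by
  have : G.edgeSet.ncard = (ES G Finset.univ).card := by
    rw [← Set.ncard_coe_finset]; congr 1; ext e; simp [ES]
  simp [pot, pS, this]

lemma pot_iso {V W : Type} [Fintype V] [Fintype W] {G : SimpleGraph V} {H : SimpleGraph W}
    (e : G ≃g H) : pot G = pot H := by
  have h1 : Fintype.card V = Fintype.card W := Fintype.card_congr e.toEquiv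
  have h2 : G.edgeSet.ncard = H.edgeSet.ncard := Nat.card_congr e.mapEdgeSet
  simp [pot, h1, h2]

lemma exists_PC {V : Type} [Fintype V] {G : SimpleGraph V} (h : Critical52 G) (S : Finset V)
    (hS : S ≠ Finset.univ) : ∃ φ, PC G S φ := by
  have hne : (⊤ : G.Subgraph).induce (S : Set V) ≠ ⊤ := by
    intro hh
    apply hS
    have := congrArg Subgraph.verts hh
    simpa using this
  obtain ⟨f⟩ := h.2 _ hne
  refine ⟨fun a => if ha : a ∈ S then f ⟨a, by simpa using ha⟩ else 0, ?_⟩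
  intro a ha b hb hab
  simp only [ha, hb, dif_pos]
  apply f.map_rel
  simp [ha, hb, hab]

lemma not_PC {V : Type} [Fintype V] {G : SimpleGraph V} (h : Critical52 G) (φ : V → Fin 5)
    (hφ : ∀ a b, G.Adj a b → c5 (φ a) (φ b)) : False :=
  h.1.false ⟨φ, fun {a b} hab => hφ a b hab⟩

lemma exists_adj_ne {V : Type} [Fintype V] {G : SimpleGraph V} (h : Critical52 G) (z p : V) :
    ∃ n, G.Adj z n ∧ n ≠ p := by
  by_contra! hcon
  obtain ⟨φ, hφ⟩ := exists_PC h (Finset.univ.erase z) (by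
    intro hh
    have := Finset.mem_univ z
    rw [← hh] at this
    simp at this)
  have hc : ∀ c : Fin 5, c5 (c + 1) c := by decide
  refine not_PC h (fun a => if a = z then φ p + 1 else φ a) ?_
  intro a b hab
  by_cases ha : a = z
  · subst ha
    have hb := hcon b hab
    subst hb
    have : b ≠ a := hab.ne'
    simp [this, hc]
  · by_cases hb : b = z
    · subst hb
      have ha' := hcon a hab.symm
      subst ha'
      simp only [ha, if_true, if_false]
      exact (hc _).symm
    · simp only [ha, hb, if_false]
      exact hφ a (by simp [ha]) b (by simp [hb]) hab

lemma exists_crit {U : Type} [Fintype U] (K : SimpleGraph U) (hK : IsEmpty (K →g cycleGraph 5)) :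
    ∃ (m : ℕ) (W : SimpleGraph (Fin m)) (i : Fin m → U), Function.Injective i ∧
      (∀ a b, W.Adj a b → K.Adj (i a) (i b)) ∧ Critical52 W := by
  obtain ⟨A, hA, hmin⟩ := exists_minimal_of_wellFoundedLT
    (fun A : K.Subgraph => IsEmpty (A.coe →g cycleGraph 5))
    ⟨⊤, ⟨fun f => hK.false (f.comp Subgraph.topIso.symm.toHom)⟩⟩
  let e := Fintype.equivFin A.verts
  let W : SimpleGraph (Fin (Fintype.card A.verts)) := A.coe.comap e.symm
  let iso : W ≃g A.coe := ⟨e.symm, by intro a b; rfl⟩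
  let f : W →g K := A.hom.comp iso.toHom
  have hf : Function.Injective f := by
    intro a b hab
    exact e.symm.injective (Subtype.ext hab)
  have htop : Subgraph.map f ⊤ = A := by
    ext a b
    · simp only [Subgraph.map_verts, Subgraph.verts_top, Set.image_univ, Set.mem_range]
      constructor
      · rintro ⟨y, rfl⟩; exact (e.symm y).2
      · intro ha; exact ⟨e ⟨a, ha⟩, by simp [f, iso]⟩
    · simp only [Subgraph.map_adj, Relation.Map, Subgraph.top_adj]
      constructor
      · rintro ⟨y, z, hyz, rfl, rfl⟩; exact hyz
      · intro hab
        exact ⟨e ⟨a, A.edge_vert hab⟩, e ⟨b, A.edge_vert hab.symm⟩, by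
          simp only [W, comap_adj, Equiv.symm_apply_apply]; exact hab, by simp [f, iso], by simp [f, iso]⟩
  refine ⟨_, W, f, hf, fun a b hab => f.map_rel hab, ⟨fun g => hA.false (g.comp iso.symm.toHom)⟩, ?_⟩
  intro H hH
  by_contra hcon
  rw [not_nonempty_iff] at hcon
  have hle : Subgraph.map f H ≤ A := by
    exact (Subgraph.map_mono le_top).trans htop.le
  have hemp : IsEmpty ((Subgraph.map f H).coe →g cycleGraph 5) := by
    refine ⟨fun g => hcon.false ⟨fun y => g ⟨f y, ⟨y, y.2, rfl⟩⟩, ?_⟩⟩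
    intro a b hab
    apply g.map_rel
    simp only [Subgraph.coe_adj, Subgraph.map_adj, Relation.Map]
    exact ⟨a, b, hab, rfl, rfl⟩
  have hge := hmin hemp hle
  apply hH
  rw [eq_top_iff]
  have h2 : Subgraph.map f ⊤ ≤ Subgraph.map f H := htop.le.trans hge
  constructor
  · intro y _
    have : f y ∈ (Subgraph.map f H).verts := h2.1 ⟨y, trivial, rfl⟩
    obtain ⟨z, hz, hzy⟩ := this
    rw [← hf hzy]; exact hz
  · intro a b hab
    have : (Subgraph.map f H).Adj (f a) (f b) := h2.2 ⟨a, b, hab, rfl, rfl⟩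
    obtain ⟨a', b', h', ha, hb⟩ := this
    rw [← hf ha, ← hf hb]; exact h'

lemma pS_insert {V : Type} [Fintype V] (G : SimpleGraph V) (S N : Finset V) (z : V) (hz : z ∉ S)
    (hN : N ⊆ S) (hadj : ∀ n ∈ N, G.Adj z n) :
    pS G (insert z S) ≤ pS G S + 5 - 4 * N.card := by
  have h1 : ES G S ∪ N.image (fun n => s(z, n)) ⊆ ES G (insert z S) := by
    apply Finset.union_subset (ES_mono G (Finset.subset_insert _ _))
    intro e he
    obtain ⟨n, hn, rfl⟩ := Finset.mem_image.1 he
    rw [mem_ES]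
    exact ⟨hadj n hn, by simp, by simp [hN hn]⟩
  have h2 : Disjoint (ES G S) (N.image (fun n => s(z, n))) := by
    rw [Finset.disjoint_left]
    intro e he he'
    obtain ⟨n, hn, rfl⟩ := Finset.mem_image.1 he'
    rw [mem_ES] at he
    exact hz he.2.1
  have h3 : (N.image (fun n => s(z, n))).card = N.card := by
    apply Finset.card_image_of_injective
    intro a b hab
    simp at hab; grind
  have h4 := Finset.card_le_card h1
  rw [Finset.card_union_of_disjoint h2, h3] at h4
  simp only [pS, Finset.card_insert_of_notMem hz]
  push_cast
  have : ((ES G S).card : ℤ) + N.card ≤ (ES G (insert z S)).card := by exact_mod_cast h4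
  linarith

lemma pS_ins1 {V : Type} [Fintype V] {G : SimpleGraph V} {S : Finset V} {z n : V} (hz : z ∉ S)
    (hn : n ∈ S) (h : G.Adj z n) : pS G (insert z S) ≤ pS G S + 1 := by
  have := pS_insert G S {n} z hz (by simpa using hn) (by simpa using h)
  simp at this; linarith

lemma pS_ins2 {V : Type} [Fintype V] {G : SimpleGraph V} {S : Finset V} {z n n' : V} (hz : z ∉ S)
    (hnn : n ≠ n') (hn : n ∈ S) (hn' : n' ∈ S) (h : G.Adj z n) (h' : G.Adj z n') :
    pS G (insert z S) ≤ pS G S - 3 := by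
  have := pS_insert G S {n, n'} z hz (by intro y; simp; grind) (by simp [h, h'])
  rw [Finset.card_pair hnn] at this
  push_cast at this; linarith

lemma pS_ins3 {V : Type} [Fintype V] {G : SimpleGraph V} {S : Finset V} {z n n' n'' : V} (hz : z ∉ S)
    (h1 : n ≠ n') (h2 : n ≠ n'') (h3 : n' ≠ n'') (hn : n ∈ S) (hn' : n' ∈ S) (hn'' : n'' ∈ S)
    (h : G.Adj z n) (h' : G.Adj z n') (h'' : G.Adj z n'') :
    pS G (insert z S) ≤ pS G S - 7 := by
  have := pS_insert G S {n, n', n''} z hz (by intro y; simp; grind) (by simp [h, h', h''])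
  rw [Finset.card_eq_three.2 ⟨n, n', n'', h1, h2, h3, rfl⟩] at this
  push_cast at this; linarith

end Pf

namespace Pf
open scoped Classical

lemma cex_cases {V : Type} [Fintype V] {G : SimpleGraph V} (h : SmallestCex G) {m : ℕ}
    (W : SimpleGraph (Fin m)) (hW : Critical52 W) (hm : m < Fintype.card V) :
    pot W ≤ 1 ∨ Nonempty (W ≃g cycleGraph 3) ∨ Nonempty (W ≃g E1) ∨ Nonempty (W ≃g E2) := by
  obtain ⟨_, _, _, _, _, h6⟩ := h
  by_cases h1 : Nonempty (W ≃g cycleGraph 3)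
  · tauto
  by_cases h2 : Nonempty (W ≃g E1)
  · tauto
  by_cases h3 : Nonempty (W ≃g E2)
  · tauto
  left
  rw [not_nonempty_iff] at h1 h2 h3
  exact h6 m W hW h1 h2 h3 hm

lemma pot_C3 : pot (cycleGraph 3) = 3 := by
  have : (cycleGraph 3).edgeSet.ncard = 3 := by
    rw [Set.ncard_eq_toFinset_card']
    decide
  simp [pot, this]

lemma pot_E1 : pot E1 = 2 := by
  have : E1.edgeSet.ncard = 12 := by
    have h : E1.edgeSet = (({s(0,1), s(1,2), s(2,3), s(3,4), s(4,5), s(5,6), s(6,7), s(7,8), s(8,0),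
        s(9,0), s(9,3), s(9,6)} : Finset (Sym2 (Fin 10))) : Set (Sym2 (Fin 10))) := by
      rw [E1, edgeSet_fromEdgeSet]
      ext e
      simp only [Set.mem_sdiff, Finset.coe_insert, Finset.coe_singleton]
      constructor
      · exact fun h => h.1
      · intro h
        refine ⟨h, ?_⟩
        simp only [Set.mem_insert_iff, Set.mem_singleton_iff] at h
        rcases h with h | h | h | h | h | h | h | h | h | h | h | h <;> subst h <;> simp
    rw [h, Set.ncard_coe_finset]
    decide
  simp [pot, this]

lemma pot_E2 : pot E2 = 2 := by
  have : E2.edgeSet.ncard = 12 := by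
    have h : E2.edgeSet = (({s(0,1), s(1,2), s(2,3), s(3,4), s(4,0),
        s(1,5), s(5,6), s(6,7), s(7,0),
        s(3,8), s(8,9), s(9,6)} : Finset (Sym2 (Fin 10))) : Set (Sym2 (Fin 10))) := by
      rw [E2, edgeSet_fromEdgeSet]
      ext e
      simp only [Set.mem_sdiff, Finset.coe_insert, Finset.coe_singleton]
      constructor
      · exact fun h => h.1
      · intro h
        refine ⟨h, ?_⟩
        simp only [Set.mem_insert_iff, Set.mem_singleton_iff] at h
        rcases h with h | h | h | h | h | h | h | h | h | h | h | h <;> subst h <;> simp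
    rw [h, Set.ncard_coe_finset]
    decide
  simp [pot, this]

/-- classification of smaller critical graphs with potentials -/
lemma cex_cases' {V : Type} [Fintype V] {G : SimpleGraph V} (h : SmallestCex G) {m : ℕ}
    (W : SimpleGraph (Fin m)) (hW : Critical52 W) (hm : m < Fintype.card V) :
    pot W ≤ 1 ∨ (Nonempty (W ≃g cycleGraph 3) ∧ pot W = 3 ∧ m = 3) ∨
      ((Nonempty (W ≃g E1) ∨ Nonempty (W ≃g E2)) ∧ pot W = 2 ∧ m = 10) := by
  rcases cex_cases h W hW hm with h1 | ⟨⟨e⟩⟩ | ⟨⟨e⟩⟩ | ⟨⟨e⟩⟩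
  · exact Or.inl h1
  · refine Or.inr (Or.inl ⟨⟨e⟩, (pot_iso e).trans pot_C3, ?_⟩)
    simpa using Fintype.card_congr e.toEquiv
  · refine Or.inr (Or.inr ⟨Or.inl ⟨e⟩, (pot_iso e).trans pot_E1, ?_⟩)
    simpa using Fintype.card_congr e.toEquiv
  · refine Or.inr (Or.inr ⟨Or.inr ⟨e⟩, (pot_iso e).trans pot_E2, ?_⟩)
    simpa using Fintype.card_congr e.toEquiv

/-- the collapsing map -/
noncomputable def fS {V : Type} (S : Finset V) (φ : V → Fin 5) (a : V) : V ⊕ Fin 5 :=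
  if a ∈ S then Sum.inr (φ a) else Sum.inl a

lemma fS_inl {V : Type} {S : Finset V} {φ : V → Fin 5} {a b : V} (h : fS S φ a = Sum.inl b) :
    a = b ∧ a ∉ S := by
  unfold fS at h
  split_ifs at h with h1
  exact ⟨Sum.inl.inj h, h1⟩

lemma fS_inr {V : Type} {S : Finset V} {φ : V → Fin 5} {a : V} {c : Fin 5}
    (h : fS S φ a = Sum.inr c) : φ a = c ∧ a ∈ S := by
  unfold fS at h
  split_ifs at h with h1
  exact ⟨Sum.inr.inj h, h1⟩

/-- The collapsed graph contains a critical graph; main step of the potential method. -/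
lemma step {V : Type} [Fintype V] {G : SimpleGraph V} (hc : Critical52 G) (S : Finset V)
    (hne : S.Nonempty) (φ : V → Fin 5) (hφ : PC G S φ)
    (hinj : ¬ Set.InjOn φ S) :
    ∃ (m : ℕ) (W : SimpleGraph (Fin m)) (i : Fin m → V ⊕ Fin 5) (T : Finset V) (A : Finset (Fin 5)),
      Function.Injective i ∧ Critical52 W ∧
      (∀ a b, W.Adj a b → ∃ s t, G.Adj s t ∧ fS S φ s = i a ∧ fS S φ t = i b) ∧
      T.Nonempty ∧ Disjoint S T ∧ A.Nonempty ∧ (∀ a, a ∈ T ↔ ∃ k, i k = Sum.inl a) ∧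
      (∀ c, c ∈ A ↔ ∃ k, i k = Sum.inr c) ∧ T.card + A.card = m ∧ m < Fintype.card V ∧
      pS G (S ∪ T) ≤ pS G S + pot W - (5 * (A.card : ℤ) - 4 * (e5 A : ℤ)) := by
  let K : SimpleGraph (V ⊕ Fin 5) :=
    { Adj := fun p q => ∃ s t, G.Adj s t ∧ fS S φ s = p ∧ fS S φ t = q
      symm := ⟨fun p q ⟨s, t, h1, h2, h3⟩ => ⟨t, s, h1.symm, h3, h2⟩⟩
      loopless := ⟨by
        rintro p ⟨s, t, h1, h2, h3⟩
        rcases p with p | p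
        · have h2' := fS_inl h2
          have h3' := fS_inl h3
          exact h1.ne (h2'.1.trans h3'.1.symm)
        · have h2' := fS_inr h2
          have h3' := fS_inr h3
          have := hφ s h2'.2 t h3'.2 h1
          rw [h2'.1, h3'.1] at this
          exact this.ne rfl⟩ }
  have hK : IsEmpty (K →g cycleGraph 5) := by
    refine ⟨fun g => not_PC hc (fun a => g (fS S φ a)) ?_⟩
    intro a b hab
    exact g.map_rel (show K.Adj _ _ from ⟨a, b, hab, rfl, rfl⟩)
  obtain ⟨m, W, i, hi, hWK, hW⟩ := exists_crit K hK
  have hnb : ∀ k, ∃ l, W.Adj k l := fun k => by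
    obtain ⟨n, hn, _⟩ := exists_adj_ne hW k k
    exact ⟨n, hn⟩
  have hTS : ∀ k a, i k = Sum.inl a → a ∉ S := by
    intro k a hk
    obtain ⟨l, hl⟩ := hnb k
    obtain ⟨s, t, h1, h2, h3⟩ := hWK _ _ hl
    rw [hk] at h2
    obtain ⟨rfl, h⟩ := fS_inl h2
    exact h
  have hAS : ∀ k c, i k = Sum.inr c → ∃ a ∈ S, φ a = c := by
    intro k a hk
    obtain ⟨l, hl⟩ := hnb k
    obtain ⟨s, t, h1, h2, h3⟩ := hWK _ _ hl
    rw [hk] at h2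
    obtain ⟨h, h'⟩ := fS_inr h2
    exact ⟨s, h', h⟩
  let T : Finset V := Finset.univ.filter (fun a => ∃ k, i k = Sum.inl a)
  let A : Finset (Fin 5) := Finset.univ.filter (fun c => ∃ k, i k = Sum.inr c)
  have hT : ∀ a, a ∈ T ↔ ∃ k, i k = Sum.inl a := by simp [T]
  have hA : ∀ c, c ∈ A ↔ ∃ k, i k = Sum.inr c := by simp [A]
  have hdisj : Disjoint S T := by
    rw [Finset.disjoint_right]
    intro a ha
    obtain ⟨k, hk⟩ := (hT a).1 ha
    exact hTS k a hk
  have himg : Finset.univ.image i = T.disjSum A := by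
    ext p
    rcases p with p | p
    · simp [hT]
    · simp [hA]
  have hcard : T.card + A.card = m := by
    rw [← Finset.card_disjSum, ← himg, Finset.card_image_of_injective _ hi]; simp
  have hAc : A.card < S.card := by
    have h1 : A ⊆ S.image φ := by
      intro c hc
      obtain ⟨k, hk⟩ := (hA c).1 hc
      obtain ⟨a, ha, hh⟩ := hAS k c hk
      exact Finset.mem_image.2 ⟨a, ha, hh⟩
    have h2 : (S.image φ).card < S.card := by
      refine lt_of_le_of_ne Finset.card_image_le (fun hh => hinj ?_)
      exact Finset.card_image_iff.1 hh
    exact (Finset.card_le_card h1).trans_lt h2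
  have hlt : m < Fintype.card V := by
    have := Finset.card_le_univ (S ∪ T)
    rw [Finset.card_union_of_disjoint hdisj] at this
    omega
  have hTne : T.Nonempty := by
    by_contra hcon
    rw [Finset.not_nonempty_iff_eq_empty] at hcon
    have : ∀ k, ∃ c, i k = Sum.inr c := by
      intro k
      rcases hk : i k with p | p
      · have := (hT p).2 ⟨k, hk⟩
        simp [hcon] at this
      · exact ⟨p, rfl⟩
    choose g hg using this
    refine not_PC hW g ?_
    intro a b hab
    obtain ⟨s, t, h1, h2, h3⟩ := hWK _ _ hab
    rw [hg] at h2 h3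
    obtain ⟨h4, h5⟩ := fS_inr h2
    obtain ⟨h6, h7⟩ := fS_inr h3
    rw [← h4, ← h6]
    exact hφ s h5 t h7 h1
  have hAne : A.Nonempty := by
    by_contra hcon
    rw [Finset.not_nonempty_iff_eq_empty] at hcon
    have : ∀ k, ∃ c, i k = Sum.inl c := by
      intro k
      rcases hk : i k with p | p
      · exact ⟨p, rfl⟩
      · have := (hA p).2 ⟨k, hk⟩
        simp [hcon] at this
    choose g hg using this
    obtain ⟨ψ, hψ⟩ := exists_PC hc (Finset.univ \ S) (by
      obtain ⟨s, hs⟩ := hne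
      intro hh
      have := Finset.mem_univ s
      rw [← hh] at this
      simp [hs] at this)
    refine not_PC hW (fun k => ψ (g k)) ?_
    intro a b hab
    obtain ⟨s, t, h1, h2, h3⟩ := hWK _ _ hab
    rw [hg] at h2 h3
    obtain ⟨h4, h5⟩ := fS_inl h2
    obtain ⟨h6, h7⟩ := fS_inl h3
    simp only [← h4, ← h6]
    exact hψ s (by simp [h5]) t (by simp [h7]) h1
  refine ⟨m, W, i, T, A, hi, hW, hWK, hTne, hdisj, hAne, hT, hA, hcard, hlt, ?_⟩
  -- edge count
  have hsub : (ES W Finset.univ).image (Sym2.map i) ⊆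
      ((Finset.univ.filter (fun k : Fin 5 => k ∈ A ∧ k + 1 ∈ A)).image
        (fun k => (s(Sum.inr k, Sum.inr (k + 1)) : Sym2 (V ⊕ Fin 5)))) ∪
      (ES G (S ∪ T) \ ES G S).image (Sym2.map (fS S φ)) := by
    intro e he
    obtain ⟨e', he', rfl⟩ := Finset.mem_image.1 he
    induction e' using Sym2.ind with
    | _ a b =>
    rw [mem_ES] at he'
    obtain ⟨s, t, h1, h2, h3⟩ := hWK _ _ he'.1
    rw [Finset.mem_union]
    by_cases hst : s ∈ S ∧ t ∈ S
    · left
      have h4 : i a = Sum.inr (φ s) := by rw [← h2]; simp [fS, hst.1]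
      have h5 : i b = Sum.inr (φ t) := by rw [← h3]; simp [fS, hst.2]
      have h6 := hφ s hst.1 t hst.2 h1
      have h7 : ∀ a b : Fin 5, c5 a b → (b = a + 1 ∨ a = b + 1) := by decide
      have h8 : φ s ∈ A := (hA _).2 ⟨a, h4⟩
      have h9 : φ t ∈ A := (hA _).2 ⟨b, h5⟩
      rw [Finset.mem_image]
      rcases h7 _ _ h6 with h10 | h10
      · refine ⟨φ s, ?_, ?_⟩
        · simp [h8, ← h10, h9]
        · simp [h4, h5, h10]
      · refine ⟨φ t, ?_, ?_⟩
        · simp [h9, ← h10, h8]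
        · rw [Sym2.map_mk, h4, h5, Sym2.eq_swap]; simp [h10]
    · right
      rw [Finset.mem_image]
      have key : ∀ s k, fS S φ s = i k → s ∈ S ∪ T := by
        intro s k hk
        by_cases hs : s ∈ S
        · simp [hs]
        · have : i k = Sum.inl s := by rw [← hk]; simp [fS, hs]
          simp [(hT s).2 ⟨k, this⟩]
      refine ⟨s(s, t), ?_, ?_⟩
      · rw [Finset.mem_sdiff, mem_ES, mem_ES]
        exact ⟨⟨h1, key s a h2, key t b h3⟩, fun hh => hst hh.2⟩
      · simp [h2, h3]
  have h1 := Finset.card_le_card hsub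
  rw [Finset.card_image_of_injective _ (Sym2.map.injective hi)] at h1
  have h2 := Finset.card_union_le ((Finset.univ.filter (fun k : Fin 5 => k ∈ A ∧ k + 1 ∈ A)).image
        (fun k => (s(Sum.inr k, Sum.inr (k + 1)) : Sym2 (V ⊕ Fin 5))))
      ((ES G (S ∪ T) \ ES G S).image (Sym2.map (fS S φ)))
  have h3 : ((Finset.univ.filter (fun k : Fin 5 => k ∈ A ∧ k + 1 ∈ A)).image
        (fun k => (s(Sum.inr k, Sum.inr (k + 1)) : Sym2 (V ⊕ Fin 5)))).card ≤ e5 A := by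
    refine Finset.card_image_le.trans (le_of_eq ?_)
    unfold e5
    congr
  have h4 : ((ES G (S ∪ T) \ ES G S).image (Sym2.map (fS S φ))).card ≤
    (ES G (S ∪ T) \ ES G S).card := Finset.card_image_le
  have h5 := Finset.card_sdiff_add_card_eq_card (ES_mono G (Finset.subset_union_left (s₁ := S) (s₂ := T)))
  have h6 : ((ES W Finset.univ).card : ℤ) + (ES G S).card ≤ e5 A + (ES G (S ∪ T)).card := by
    exact_mod_cast (by omega)
  rw [pot_eq]
  simp only [pS, Finset.card_union_of_disjoint hdisj, Finset.card_univ, Fintype.card_fin]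
  push_cast
  have : (m : ℤ) = T.card + A.card := by exact_mod_cast hcard.symm
  linarith

lemma pS_univ_ge {V : Type} [Fintype V] {G : SimpleGraph V} (h : SmallestCex G) :
    2 ≤ pS G Finset.univ := by
  rw [← pot_eq]; exact h.2.2.2.2.1

lemma pS_inj {V : Type} [Fintype V] {G : SimpleGraph V} (S : Finset V) (hne : S.Nonempty)
    (φ : V → Fin 5) (hφ : PC G S φ) (hinj : Set.InjOn φ S) : 5 ≤ pS G S := by
  have h1 : (S.image φ).card = S.card := Finset.card_image_iff.2 hinj
  have h2 : (ES G S).card ≤ e5 (S.image φ) := by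
    have hsub : (ES G S).image (Sym2.map φ) ⊆
        ((Finset.univ.filter (fun k : Fin 5 => k ∈ S.image φ ∧ k + 1 ∈ S.image φ)).image
        (fun k => s(k, k + 1))) := by
      intro e he
      obtain ⟨e', he', rfl⟩ := Finset.mem_image.1 he
      induction e' using Sym2.ind with
      | _ s t =>
      rw [mem_ES] at he'
      have h6 := hφ s he'.2.1 t he'.2.2 he'.1
      have h7 : ∀ a b : Fin 5, c5 a b → (b = a + 1 ∨ a = b + 1) := by decide
      have h8 : φ s ∈ S.image φ := Finset.mem_image_of_mem _ he'.2.1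
      have h9 : φ t ∈ S.image φ := Finset.mem_image_of_mem _ he'.2.2
      rw [Finset.mem_image]
      rcases h7 _ _ h6 with h10 | h10
      · refine ⟨φ s, ?_, ?_⟩
        · rw [Finset.mem_filter]; exact ⟨Finset.mem_univ _, h8, by rw [← h10]; exact h9⟩
        · simp [h10]
      · refine ⟨φ t, ?_, ?_⟩
        · rw [Finset.mem_filter]; exact ⟨Finset.mem_univ _, h9, by rw [← h10]; exact h8⟩
        · rw [Sym2.map_mk, Sym2.eq_swap]; simp [h10]
    have h3 : ((ES G S).image (Sym2.map φ)).card = (ES G S).card := by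
      apply Finset.card_image_iff.2
      intro e he e' he' hee
      induction e using Sym2.ind with
      | _ a b =>
      induction e' using Sym2.ind with
      | _ c d =>
      simp only [Finset.mem_coe, mem_ES] at he he'
      simp only [Sym2.map_mk, Sym2.eq_iff] at hee ⊢
      rcases hee with hee | hee
      · exact Or.inl ⟨hinj he.2.1 he'.2.1 hee.1, hinj he.2.2 he'.2.2 hee.2⟩
      · exact Or.inr ⟨hinj he.2.1 he'.2.2 hee.1, hinj he.2.2 he'.2.1 hee.2⟩
    rw [← h3]
    refine (Finset.card_le_card hsub).trans (Finset.card_image_le.trans (le_of_eq ?_))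
    unfold e5
    congr
  have h3 := (e5_bound (S.image φ) (hne.image φ)).1
  rw [h1] at h3
  simp only [pS]
  omega

lemma lemA0 {V : Type} [Fintype V] {G : SimpleGraph V} (h : SmallestCex G) :
    ∀ (n : ℕ) (S : Finset V), Fintype.card V - S.card ≤ n → S.Nonempty → S ≠ Finset.univ →
      4 ≤ pS G S := by
  intro n
  induction n with
  | zero =>
    intro S hn hne hp
    exfalso
    apply hp
    rw [← Finset.card_eq_iff_eq_univ]
    have := Finset.card_le_univ S
    omega
  | succ n ih =>
    intro S hn hne hp
    by_contra hcon
    push Not at hcon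
    obtain ⟨φ, hφ⟩ := exists_PC h.1 S hp
    have hinj : ¬ Set.InjOn φ S := fun hi => by
      have := pS_inj S hne φ hφ hi
      omega
    obtain ⟨m, W, i, T, A, hi, hW, hWK, hTne, hdisj, hAne, hT, hA, hcard, hlt, hpot⟩ :=
      step h.1 S hne φ hφ hinj
    have h1 := (e5_bound A hAne).1
    have h2 : pot W ≤ 3 := by
      rcases cex_cases' h W hW hlt with h | ⟨_, h, _⟩ | ⟨_, h, _⟩ <;> omega
    have h3 : pS G (S ∪ T) ≤ 1 := by omega
    have h4 := hTne.card_pos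
    have h5 := Finset.card_union_of_disjoint hdisj
    by_cases hu : S ∪ T = Finset.univ
    · have := pS_univ_ge h
      rw [hu] at h3; omega
    · have := ih (S ∪ T) (by omega) (hne.mono Finset.subset_union_left) hu
      omega

lemma lemA0' {V : Type} [Fintype V] {G : SimpleGraph V} (h : SmallestCex G) (S : Finset V)
    (hne : S.Nonempty) (hp : S ≠ Finset.univ) : 4 ≤ pS G S :=
  lemA0 h _ S le_rfl hne hp

/-- a set with at most two missing vertices, one of them of degree at least three -/
lemma two_missing {V : Type} [Fintype V] {G : SimpleGraph V} (h : SmallestCex G) (S T : Finset V)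
    (hdisj : Disjoint S T) (hu : S ∪ T = Finset.univ) (hT : T.card ≤ 2) (hp : pS G S ≤ 5)
    (z n1 n2 n3 : V) (hz : z ∉ S) (hz1 : G.Adj z n1) (hz2 : G.Adj z n2) (hz3 : G.Adj z n3)
    (h12 : n1 ≠ n2) (h13 : n1 ≠ n3) (h23 : n2 ≠ n3) : False := by
  have hmem : ∀ y, y ∈ S ∨ y ∈ T := by
    intro y
    have := Finset.mem_univ y
    rwa [← hu, Finset.mem_union] at this
  have hzT : z ∈ T := (hmem z).resolve_left hz
  have hpu := pS_univ_ge h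
  have hn1 := hz1.ne
  have hn2 := hz2.ne
  have hn3 := hz3.ne
  have hcase : T = {z} ∨ ∃ y, y ≠ z ∧ T = {z, y} := by
    have hpos : 0 < T.card := Finset.card_pos.2 ⟨z, hzT⟩
    have : T.card = 1 ∨ T.card = 2 := by omega
    rcases this with h1 | h1
    · obtain ⟨a, rfl⟩ := Finset.card_eq_one.1 h1
      simp at hzT
      simp [hzT]
    · obtain ⟨a, b, hab, rfl⟩ := Finset.card_eq_two.1 h1
      simp at hzT
      rcases hzT with rfl | rfl
      · exact Or.inr ⟨b, hab.symm, rfl⟩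
      · exact Or.inr ⟨a, hab, Finset.pair_comm _ _⟩
  rcases hcase with rfl | ⟨y, hy, rfl⟩
  · have e : insert z S = Finset.univ := by rw [← hu]; ext; simp
    have key := pS_ins3 (G := G) hz h12 h13 h23 (by have := hmem n1; simp at this; grind)
      (by have := hmem n2; simp at this; grind) (by have := hmem n3; simp at this; grind) hz1 hz2 hz3
    rw [e] at key
    omega
  · have hyS : y ∉ S := fun hh => Finset.disjoint_left.1 hdisj hh (by simp)
    obtain ⟨n, hn, hnz⟩ := exists_adj_ne h.1 y z
    have hnS : n ∈ S := by
      have h1 := hmem n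
      have h2 := hn.ne
      simp at h1; grind
    have k1 := pS_ins1 hyS hnS hn
    have e : insert z (insert y S) = Finset.univ := by
      rw [← hu]; ext; simp
    have key := pS_ins3 (G := G) (S := insert y S) (z := z) (by simp [hz, hy.symm]) h12 h13 h23
      (by have := hmem n1; simp at this ⊢; grind)
      (by have := hmem n2; simp at this ⊢; grind) (by have := hmem n3; simp at this ⊢; grind) hz1 hz2 hz3
    rw [e] at key
    omega

lemma lemA {V : Type} [Fintype V] {G : SimpleGraph V} (h : SmallestCex G) (S : Finset V)
    (hne : S.Nonempty) (hp : pS G S ≤ 4)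
    (z n1 n2 n3 : V) (hz : z ∉ S) (hz1 : G.Adj z n1) (hz2 : G.Adj z n2) (hz3 : G.Adj z n3)
    (h12 : n1 ≠ n2) (h13 : n1 ≠ n3) (h23 : n2 ≠ n3) : False := by
  have hS : S ≠ Finset.univ := fun hh => hz (hh ▸ Finset.mem_univ z)
  obtain ⟨φ, hφ⟩ := exists_PC h.1 S hS
  have hinj : ¬ Set.InjOn φ S := fun hi => by
    have := pS_inj S hne φ hφ hi
    omega
  obtain ⟨m, W, i, T, A, hi, hW, hWK, hTne, hdisj, hAne, hT, hA, hcard, hlt, hpot⟩ :=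
    step h.1 S hne φ hφ hinj
  have h1 := (e5_bound A hAne).1
  have hA1 := hAne.card_pos
  have hu : S ∪ T = Finset.univ := by
    by_contra hu
    have h5 := lemA0' h (S ∪ T) (hne.mono Finset.subset_union_left) hu
    rcases cex_cases' h W hW hlt with h | ⟨_, h, _⟩ | ⟨_, h, _⟩ <;> omega
  have hge := pS_univ_ge h
  rw [hu] at hpot
  rcases cex_cases' h W hW hlt with h' | ⟨_, h', hm⟩ | ⟨_, h', _⟩
  · omega
  · exact two_missing h S T hdisj hu (by omega) (by omega) z n1 n2 n3 hz hz1 hz2 hz3 h12 h13 h23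
  · omega

lemma lemB {V : Type} [Fintype V] {G : SimpleGraph V} (h : SmallestCex G) (S : Finset V)
    (hS6 : 6 ≤ S.card) (hp : pS G S ≤ 5)
    (z n1 n2 n3 : V) (hz : z ∉ S) (hz1 : G.Adj z n1) (hz2 : G.Adj z n2) (hz3 : G.Adj z n3)
    (h12 : n1 ≠ n2) (h13 : n1 ≠ n3) (h23 : n2 ≠ n3) :
    ∃ (m : ℕ) (W : SimpleGraph (Fin m)) (i : Fin m → V ⊕ Fin 5) (φ : V → Fin 5),
      Function.Injective i ∧ Critical52 W ∧ (Nonempty (W ≃g E1) ∨ Nonempty (W ≃g E2)) ∧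
      (∀ a b, W.Adj a b → ∃ s t, G.Adj s t ∧ fS S φ s = i a ∧ fS S φ t = i b) ∧
      (∀ a, a ∉ S ↔ ∃ k, i k = Sum.inl a) := by
  have hS : S ≠ Finset.univ := fun hh => hz (hh ▸ Finset.mem_univ z)
  have hne : S.Nonempty := Finset.card_pos.1 (by omega)
  obtain ⟨φ, hφ⟩ := exists_PC h.1 S hS
  have hinj : ¬ Set.InjOn φ S := fun hi => by
    have h1 : (S.image φ).card = S.card := Finset.card_image_iff.2 hi
    have h2 := Finset.card_le_univ (S.image φ)
    simp at h2
    omega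
  obtain ⟨m, W, i, T, A, hi, hW, hWK, hTne, hdisj, hAne, hT, hA, hcard, hlt, hpot⟩ :=
    step h.1 S hne φ hφ hinj
  have h1 := (e5_bound A hAne)
  have hA1 := hAne.card_pos
  have hu : S ∪ T = Finset.univ := by
    by_contra hu
    have h5 := lemA0' h (S ∪ T) (hne.mono Finset.subset_union_left) hu
    rcases cex_cases' h W hW hlt with h | ⟨_, h, _⟩ | ⟨_, h, _⟩ <;> omega
  have hge := pS_univ_ge h
  rw [hu] at hpot
  rcases cex_cases' h W hW hlt with h' | ⟨_, h', hm⟩ | ⟨hE, h', hm⟩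
  · omega
  · exact (two_missing h S T hdisj hu (by omega) (by omega) z n1 n2 n3 hz hz1 hz2 hz3 h12 h13 h23).elim
  · have hTS : Finset.univ \ S = T := by
      ext y
      have h3 := Finset.mem_univ y
      rw [← hu, Finset.mem_union] at h3
      have h4 : y ∈ S → y ∉ T := fun hy => Finset.disjoint_left.1 hdisj hy
      simp; tauto
    refine ⟨m, W, i, φ, hi, hW, hE, hWK, ?_⟩
    intro a
    rw [← hT, ← hTS]; simp

end Pf

namespace Pf

/-- neighbour lists of `E1` -/
def nb1 (a : Fin 10) : List (Fin 10) :=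
  match a with
  | 0 => [1, 8, 9] | 1 => [0, 2] | 2 => [1, 3] | 3 => [2, 4, 9] | 4 => [3, 5]
  | 5 => [4, 6] | 6 => [5, 7, 9] | 7 => [6, 8] | 8 => [7, 0] | 9 => [0, 3, 6]

/-- neighbour lists of `E2` -/
def nb2 (a : Fin 10) : List (Fin 10) :=
  match a with
  | 0 => [1, 4, 7] | 1 => [0, 2, 5] | 2 => [1, 3] | 3 => [2, 4, 8] | 4 => [3, 0]
  | 5 => [1, 6] | 6 => [5, 7, 9] | 7 => [6, 0] | 8 => [3, 9] | 9 => [8, 6]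

lemma E1_adj (a b : Fin 10) : E1.Adj a b ↔ b ∈ nb1 a := by
  simp only [E1, fromEdgeSet_adj, Set.mem_insert_iff, Set.mem_singleton_iff]
  revert a b
  decide +kernel

lemma E2_adj (a b : Fin 10) : E2.Adj a b ↔ b ∈ nb2 a := by
  simp only [E2, fromEdgeSet_adj, Set.mem_insert_iff, Set.mem_singleton_iff]
  revert a b
  decide +kernel

/-- two-step reachability in the 5-cycle -/
def r2 (a b : Fin 5) : Prop := ∃ s, c5 a s ∧ c5 s b

/-- boolean version -/
def rb (a b : Fin 5) : Bool := a == b || b == a + 2 || a == b + 2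

lemma rb_r2 : ∀ a b : Fin 5, rb a b = true → ∃ s, c5 a s ∧ c5 s b := by decide +kernel

lemma r2_rb : ∀ a b s : Fin 5, c5 s a → c5 s b → rb a b = true := by decide +kernel

/-- the colour `t` at `v` is compatible with a friend whose other friends have colours `p`, `q` -/
def ok (t p q : Fin 5) : Prop := ∃ u, r2 t u ∧ r2 u p ∧ r2 u q

/-- boolean version -/
def okb (t p q : Fin 5) : Bool := [0, 1, 2, 3, 4].any (fun u => rb t u && rb u p && rb u q)

lemma okb_ok {t p q : Fin 5} (h : okb t p q = true) : ok t p q := by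
  simp only [okb, List.any_eq_true, Bool.and_eq_true] at h
  obtain ⟨u, _, ⟨h1, h2⟩, h3⟩ := h
  exact ⟨u, rb_r2 _ _ h1, rb_r2 _ _ h2, rb_r2 _ _ h3⟩

lemma okb_forbid : ∀ p q : Fin 5, rb p q = true → ∃ f, ∀ t, t ≠ f → okb t p q = true := by
  decide +kernel

lemma ok_forbid (p q s : Fin 5) (h1 : c5 s p) (h2 : c5 s q) : ∃ f, ∀ t, t ≠ f → ok t p q := by
  obtain ⟨f, hf⟩ := okb_forbid p q (r2_rb p q s h1 h2)
  exact ⟨f, fun t ht => okb_ok (hf t ht)⟩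

lemma avoid4 : ∀ f0 f1 f2 f3 : Fin 5, ∃ t, t ≠ f0 ∧ t ≠ f1 ∧ t ≠ f2 ∧ t ≠ f3 := by decide +kernel

lemma three_step : ∀ t p : Fin 5, t ≠ p → ∃ d1 d2, c5 t d1 ∧ c5 d1 d2 ∧ c5 d2 p := by
  decide +kernel

/-- colours for the case of two adjacent friends: `v` gets `t`, the friends get `p`, `q` -/
lemma coin_col_b : ∀ w1 w2 u3 x : Fin 5, ∃ t p q, rb t u3 = true ∧ t ≠ x ∧ rb t p = true ∧
    rb t q = true ∧ rb p q = true ∧ rb p w1 = true ∧ rb q w2 = true := by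
  decide +kernel

/-- forbidden configuration in the exceptional graphs -/
def Prop1 (E : SimpleGraph (Fin 10)) : Prop :=
  ∀ u a b b' z c1 c2 : Fin 10,
    (∀ y ∈ [a, b, b', c1, c2], ∃ p q, ∀ n, E.Adj y n → n = p ∨ n = q) →
    E.Adj u a → E.Adj u b → E.Adj u b' → a ≠ b → a ≠ b' → b ≠ b' →
    E.Adj a z → z ≠ u → E.Adj z c1 → c1 ≠ a → E.Adj c1 c2 → c2 ≠ z → False

/-- boolean check for `Prop1` -/
def chk1 (nb : Fin 10 → List (Fin 10)) : Bool :=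
  (List.finRange 10).all fun u => (nb u).all fun a => (nb u).all fun b => (nb u).all fun b' =>
    (nb a).all fun z => (nb z).all fun c1 => (nb c1).all fun c2 =>
    !(a != b && a != b' && b != b' && z != u && c1 != a && c2 != z &&
      [a, b, b', c1, c2].all fun y => (nb y).length ≤ 2)

/-- boolean check for degrees -/
def chkd (nb : Fin 10 → List (Fin 10)) : Bool :=
  (List.finRange 10).all fun y => (List.finRange 10).all fun p => (List.finRange 10).all fun q =>
    !((nb y).all fun n => n == p || n == q) || (nb y).length ≤ 2

lemma deg_of_chkd {nb : Fin 10 → List (Fin 10)} (h : chkd nb = true) (y p q : Fin 10)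
    (hy : ∀ n ∈ nb y, n = p ∨ n = q) : (nb y).length ≤ 2 := by
  simp only [chkd, List.all_eq_true, List.mem_finRange, true_implies] at h
  have := h y p q
  simp only [Bool.or_eq_true, Bool.not_eq_true', List.all_eq_false, decide_eq_true_eq] at this
  rcases this with ⟨n, hn, h1⟩ | h1
  · have := hy n hn
    simp [this] at h1
  · exact h1

lemma prop1_of {E : SimpleGraph (Fin 10)} {nb : Fin 10 → List (Fin 10)}
    (hE : ∀ a b, E.Adj a b ↔ b ∈ nb a) (h1 : chk1 nb = true) (h2 : chkd nb = true) : Prop1 E := by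
  intro u a b b' z c1 c2 hd hua hub hub' hab hab' hbb haz hzu hzc hca hcc hcz
  have hlen : ∀ y ∈ [a, b, b', c1, c2], (nb y).length ≤ 2 := by
    intro y hy
    obtain ⟨p, q, hpq⟩ := hd y hy
    exact deg_of_chkd h2 y p q (fun n hn => hpq n ((hE y n).2 hn))
  simp only [chk1, List.all_eq_true, List.mem_finRange, true_implies] at h1
  have h3 := h1 u a ((hE _ _).1 hua) b ((hE _ _).1 hub) b' ((hE _ _).1 hub') z ((hE _ _).1 haz)
    c1 ((hE _ _).1 hzc) c2 ((hE _ _).1 hcc)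
  have h4 : ([a, b, b', c1, c2].all fun y => decide ((nb y).length ≤ 2)) = true := by
    rw [List.all_eq_true]
    intro y hy
    simpa using hlen y hy
  rw [h4] at h3
  simp [hab, hab', hbb, hzu, hca, hcz] at h3

lemma prop1_E1 : Prop1 E1 := prop1_of E1_adj (by decide +kernel) (by decide +kernel)
lemma prop1_E2 : Prop1 E2 := prop1_of E2_adj (by decide +kernel) (by decide +kernel)

/-- colourings of an exceptional graph minus three degree-two vertices -/
def Prop2 (E : SimpleGraph (Fin 10)) : Prop :=
  ∀ (y g g' : Fin 3 → Fin 10) (x : Fin 10), (∀ i n, E.Adj (y i) n → n = g i ∨ n = g' i) →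
    (∀ i, E.Adj (y i) (g i)) → (∀ i, E.Adj (y i) (g' i)) →
    (∀ i, g i ≠ g' i) → Function.Injective y → (∀ i j, ¬ E.Adj (y i) (y j)) → (∀ i, x ≠ y i) →
    ∃ (ρ : Fin 10 → Fin 5) (t : Fin 5),
      (∀ a b, E.Adj a b → (∀ i, a ≠ y i) → (∀ i, b ≠ y i) → c5 (ρ a) (ρ b)) ∧ t ≠ ρ x ∧
      ∀ i, ok t (ρ (g i)) (ρ (g' i))

def L1 : List ((Fin 10 → Fin 5) × Fin 5) := [(![0, 1, 1, 0, 1, 1, 0, 1, 1, 1], 3)]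

/-- colourings used for `E2` -/
def L2 : List ((Fin 10 → Fin 5) × Fin 5) :=
  [(![0, 1, 2, 3, 4, 2, 3, 4, 2, 2], 0), (![0, 1, 0, 0, 1, 2, 3, 4, 1, 2], 3),
   (![0, 1, 2, 3, 4, 0, 0, 1, 2, 1], 3), (![0, 1, 0, 1, 0, 2, 3, 0, 0, 4], 1),
   (![0, 1, 0, 1, 0, 0, 0, 1, 0, 1], 0)]

/-- boolean adjacency in the 5-cycle -/
def c5b (a b : Fin 5) : Bool := b == a + 1 || a == b + 1

lemma c5b_c5 : ∀ a b : Fin 5, c5b a b = true → c5 a b := by decide +kernel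

/-- is `ρ`, `t` suitable -/
def good (nb : Fin 10 → List (Fin 10)) (y0 y1 y2 x : Fin 10) (ρ : Fin 10 → Fin 5) (t : Fin 5) : Bool :=
  t != ρ x && ([y0, y1, y2].all fun y => (nb y).all fun n => (nb y).all fun n' =>
    n == n' || okb t (ρ n) (ρ n')) &&
  ((List.finRange 10).all fun a => a == y0 || a == y1 || a == y2 || (nb a).all fun b =>
    b == y0 || b == y1 || b == y2 || c5b (ρ a) (ρ b))

/-- boolean check for `Prop2` -/
def chk2 (nb : Fin 10 → List (Fin 10)) (L : List ((Fin 10 → Fin 5) × Fin 5)) : Bool :=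
  (List.finRange 10).all fun y0 => 2 < (nb y0).length || (List.finRange 10).all fun y1 =>
    2 < (nb y1).length || y0 == y1 || (nb y0).contains y1 ||
    (List.finRange 10).all fun y2 =>
    2 < (nb y2).length || y0 == y2 || y1 == y2 || (nb y0).contains y2 || (nb y1).contains y2 ||
    (List.finRange 10).all fun x => x == y0 || x == y1 || x == y2 ||
    L.any fun p => good nb y0 y1 y2 x p.1 p.2

lemma prop2_of {E : SimpleGraph (Fin 10)} {nb : Fin 10 → List (Fin 10)}
    {L : List ((Fin 10 → Fin 5) × Fin 5)}
    (hE : ∀ a b, E.Adj a b ↔ b ∈ nb a) (h1 : chk2 nb L = true) (h2 : chkd nb = true) : Prop2 E := by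
  intro y g g' x hy hg hg' hgg hinj hnadj hx
  have hlen : ∀ i, ¬ (2 < (nb (y i)).length) := by
    intro i
    have := deg_of_chkd h2 (y i) (g i) (g' i) (fun n hn => hy i n ((hE _ _).2 hn))
    omega
  have hnb : ∀ i j, y j ∉ nb (y i) := fun i j hh => hnadj i j ((hE _ _).2 hh)
  have h01 : y 0 ≠ y 1 := fun hh => absurd (hinj hh) (by decide)
  have h02 : y 0 ≠ y 2 := fun hh => absurd (hinj hh) (by decide)
  have h12 : y 1 ≠ y 2 := fun hh => absurd (hinj hh) (by decide)
  simp only [chk2, List.all_eq_true, List.mem_finRange, true_implies, Bool.or_eq_true,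
    decide_eq_true_eq, beq_iff_eq, List.contains_iff_mem] at h1
  have h3 := (h1 (y 0)).resolve_left (hlen 0) (y 1)
  simp only [hlen, h01, hnb, false_or] at h3
  have h4 := h3 (y 2)
  simp only [hlen, h02, h12, hnb, false_or] at h4
  have h5 := h4 x
  simp only [hx, false_or, List.any_eq_true] at h5
  obtain ⟨⟨ρ, t⟩, _, hgood⟩ := h5
  simp only [good, Bool.and_eq_true, bne_iff_ne, List.all_eq_true, Bool.or_eq_true, beq_iff_eq,
    List.mem_finRange, true_implies] at hgood
  obtain ⟨⟨ht, hk⟩, hedge⟩ := hgood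
  refine ⟨ρ, t, ?_, ht, ?_⟩
  · intro a b hab ha hb
    have := hedge a
    simp only [ha, false_or] at this
    have := this b ((hE _ _).1 hab)
    simp only [hb, false_or] at this
    exact c5b_c5 _ _ this
  · intro i
    have hm : y i ∈ [y 0, y 1, y 2] := by fin_cases i <;> simp
    exact okb_ok ((hk (y i) hm _ ((hE _ _).1 (hg i)) _ ((hE _ _).1 (hg' i))).resolve_left (hgg i))

lemma prop2_E1 : Prop2 E1 := prop2_of (L := L1) E1_adj (by decide +kernel) (by decide +kernel)
lemma prop2_E2 : Prop2 E2 := prop2_of (L := L2) E2_adj (by decide +kernel) (by decide +kernel)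

lemma coin_col (w1 w2 u3 x : Fin 5) : ∃ t p q, r2 t u3 ∧ t ≠ x ∧ r2 t p ∧
    r2 t q ∧ r2 p q ∧ r2 p w1 ∧ r2 q w2 := by
  obtain ⟨t, p, q, h1, h2, h3, h4, h5, h6, h7⟩ := coin_col_b w1 w2 u3 x
  exact ⟨t, p, q, rb_r2 _ _ h1, h2, rb_r2 _ _ h3, rb_r2 _ _ h4, rb_r2 _ _ h5, rb_r2 _ _ h6,
    rb_r2 _ _ h7⟩

end Pf

namespace Pf
open scoped Classical

/-- the local configuration around `v` -/
structure Cfg {V : Type} (G : SimpleGraph V) (v c1 c2 x : V) (u a b b' w w' : Fin 3 → V) : Prop where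
  Nv : ∀ n, G.Adj v n ↔ n = c1 ∨ ∃ i, n = a i
  Nc1 : ∀ n, G.Adj c1 n ↔ n = v ∨ n = c2
  Nc2 : ∀ n, G.Adj c2 n ↔ n = c1 ∨ n = x
  Na : ∀ i n, G.Adj (a i) n ↔ n = v ∨ n = u i
  Nu : ∀ i n, G.Adj (u i) n ↔ n = a i ∨ n = b i ∨ n = b' i
  Nb : ∀ i n, G.Adj (b i) n ↔ n = u i ∨ n = w i
  Nb' : ∀ i n, G.Adj (b' i) n ↔ n = u i ∨ n = w' i
  ui : ∀ i j, u i = u j → i = j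
  ca : ∀ i, c1 ≠ a i
  ab : ∀ i, a i ≠ b i
  ab' : ∀ i, a i ≠ b' i
  bb' : ∀ i, b i ≠ b' i
  wu : ∀ i, w i ≠ u i
  wu' : ∀ i, w' i ≠ u i
  xu : ∀ i, x ≠ u i
  xv : x ≠ v
  vu : ∀ i, v ≠ u i
  dv : 3 ≤ deg G v
  dx : 3 ≤ deg G x
  du : ∀ i, 3 ≤ deg G (u i)
  dw : ∀ i, 3 ≤ deg G (w i)
  dw' : ∀ i, 3 ≤ deg G (w' i)
  dc1 : deg G c1 = 2
  dc2 : deg G c2 = 2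
  da : ∀ i, deg G (a i) = 2
  db : ∀ i, deg G (b i) = 2
  db' : ∀ i, deg G (b' i) = 2

lemma Cfg.swap {V : Type} {G : SimpleGraph V} {v c1 c2 x : V} {u a b b' w w' : Fin 3 → V}
    (C : Cfg G v c1 c2 x u a b b' w w') (s : Fin 3 → Bool) :
    Cfg G v c1 c2 x u a (fun i => if s i then b' i else b i) (fun i => if s i then b i else b' i)
      (fun i => if s i then w' i else w i) (fun i => if s i then w i else w' i) := by
  obtain ⟨h1, h2, h3, h4, h5, h6, h7, h8, h9, h10, h11, h12, h13, h14, h15, h16, h17, h18, h19, h20,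
    h21, h22, h23, h24, h25, h26, h27⟩ := C
  refine ⟨h1, h2, h3, h4, ?_, ?_, ?_, h8, h9, ?_, ?_, ?_, ?_, ?_, h15, h16, h17, h18, h19, h20,
    ?_, ?_, h23, h24, h25, ?_, ?_⟩ <;> intro i <;> cases s i <;> simp [*] <;> try grind

lemma Cfg.c12 {V : Type} {G : SimpleGraph V} {v c1 c2 x : V} {u a b b' w w' : Fin 3 → V}
    (C : Cfg G v c1 c2 x u a b b' w w') : c1 ≠ c2 := by
  have := (C.Nc1 c2).2 (Or.inr rfl)
  exact this.ne

lemma Cfg.ne_of_deg {V : Type} {G : SimpleGraph V} {p q : V} (h1 : 3 ≤ deg G p)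
    (h2 : deg G q = 2) : p ≠ q := by
  rintro rfl; omega

lemma Cfg.ac2 {V : Type} {G : SimpleGraph V} {v c1 c2 x : V} {u a b b' w w' : Fin 3 → V}
    (C : Cfg G v c1 c2 x u a b b' w w') (i : Fin 3) : a i ≠ c2 := by
  intro h
  have h1 := (C.Na i v).2 (Or.inl rfl)
  rw [h, C.Nc2] at h1
  rcases h1 with h1 | h1
  · exact Cfg.ne_of_deg C.dv C.dc1 h1
  · exact C.xv h1.symm

lemma Cfg.bc1 {V : Type} {G : SimpleGraph V} {v c1 c2 x : V} {u a b b' w w' : Fin 3 → V}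
    (C : Cfg G v c1 c2 x u a b b' w w') (i : Fin 3) : b i ≠ c1 := by
  intro h
  have h1 := (C.Nc1 c2).2 (Or.inr rfl)
  rw [← h, C.Nb] at h1
  rcases h1 with h1 | h1
  · exact Cfg.ne_of_deg (C.du i) C.dc2 h1.symm
  · exact Cfg.ne_of_deg (C.dw i) C.dc2 h1.symm

lemma Cfg.bc2 {V : Type} {G : SimpleGraph V} {v c1 c2 x : V} {u a b b' w w' : Fin 3 → V}
    (C : Cfg G v c1 c2 x u a b b' w w') (i : Fin 3) : b i ≠ c2 := by
  intro h
  have h1 := (C.Nc2 c1).2 (Or.inl rfl)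
  rw [← h, C.Nb] at h1
  rcases h1 with h1 | h1
  · exact Cfg.ne_of_deg (C.du i) C.dc1 h1.symm
  · exact Cfg.ne_of_deg (C.dw i) C.dc1 h1.symm

lemma Cfg.ba {V : Type} {G : SimpleGraph V} {v c1 c2 x : V} {u a b b' w w' : Fin 3 → V}
    (C : Cfg G v c1 c2 x u a b b' w w') (i j : Fin 3) : b i ≠ a j := by
  intro h
  have h1 := (C.Na j v).2 (Or.inl rfl)
  have h2 := (C.Na j (u j)).2 (Or.inr rfl)
  rw [← h, C.Nb] at h1 h2
  have h3 := C.ui i j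
  have h4 := C.vu i
  have h5 := C.vu j
  have h6 := C.ab i
  grind

lemma Cfg.wv {V : Type} {G : SimpleGraph V} {v c1 c2 x : V} {u a b b' w w' : Fin 3 → V}
    (C : Cfg G v c1 c2 x u a b b' w w') (i : Fin 3) : w i ≠ v := by
  intro h
  have h1 := ((C.Nb i (w i)).2 (Or.inr rfl)).symm
  rw [h, C.Nv] at h1
  rcases h1 with h1 | ⟨j, h1⟩
  · exact C.bc1 i h1
  · exact C.ba i j h1

lemma Cfg.ainj {V : Type} {G : SimpleGraph V} {v c1 c2 x : V} {u a b b' w w' : Fin 3 → V}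
    (C : Cfg G v c1 c2 x u a b b' w w') (i j : Fin 3) (h : a i = a j) : i = j := by
  have h1 := (C.Na i (u i)).2 (Or.inr rfl)
  rw [h, C.Na] at h1
  rcases h1 with h1 | h1
  · exact absurd h1.symm (C.vu i)
  · exact C.ui i j h1

/-- the removed vertices -/
def inD {V : Type} (v c1 c2 : V) (u a b b' : Fin 3 → V) (z : V) : Prop :=
  z = v ∨ z = c1 ∨ z = c2 ∨ ∃ i, z = a i ∨ z = u i ∨ z = b i ∨ z = b' i

structure Dist {V : Type} (v c1 c2 x : V) (u a b b' w w' : Fin 3 → V) : Prop where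
  vc1 : v ≠ c1
  vc2 : v ≠ c2
  c12 : c1 ≠ c2
  va : ∀ i, v ≠ a i
  vu : ∀ i, v ≠ u i
  vb : ∀ i, v ≠ b i
  vb' : ∀ i, v ≠ b' i
  c1a : ∀ i, c1 ≠ a i
  c1u : ∀ i, c1 ≠ u i
  c1b : ∀ i, c1 ≠ b i
  c1b' : ∀ i, c1 ≠ b' i
  c2a : ∀ i, c2 ≠ a i
  c2u : ∀ i, c2 ≠ u i
  c2b : ∀ i, c2 ≠ b i
  c2b' : ∀ i, c2 ≠ b' i
  au : ∀ i j, a i ≠ u j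
  ab : ∀ i j, a i ≠ b j
  ab' : ∀ i j, a i ≠ b' j
  ub : ∀ i j, u i ≠ b j
  ub' : ∀ i j, u i ≠ b' j
  bb' : ∀ i j, b i ≠ b' j
  ai : ∀ i j, a i = a j → i = j
  ui : ∀ i j, u i = u j → i = j
  bi : ∀ i j, b i = b j → i = j
  bi' : ∀ i j, b' i = b' j → i = j
  xD : ¬ inD v c1 c2 u a b b' x
  wD : ∀ i, ¬ inD v c1 c2 u a b b' (w i)
  wD' : ∀ i, ¬ inD v c1 c2 u a b b' (w' i)

lemma Cfg.dist {V : Type} {G : SimpleGraph V} {v c1 c2 x : V} {u a b b' w w' : Fin 3 → V}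
    (C : Cfg G v c1 c2 x u a b b' w w') (h1 : ∀ i j, w i ≠ u j) (h2 : ∀ i j, w' i ≠ u j) :
    Dist v c1 c2 x u a b b' w w' := by
  have C' : Cfg G v c1 c2 x u a b' b w' w := by
    have := C.swap (fun _ => true)
    simpa using this
  have nd : ∀ {p q : V}, 3 ≤ deg G p → deg G q = 2 → p ≠ q := fun h1 h2 => Cfg.ne_of_deg h1 h2
  refine ⟨nd C.dv C.dc1, nd C.dv C.dc2, C.c12, fun i => nd C.dv (C.da i), C.vu, fun i => nd C.dv (C.db i),
    fun i => nd C.dv (C.db' i), C.ca, fun i => (nd (C.du i) C.dc1).symm, fun i => (C.bc1 i).symm,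
    fun i => (C'.bc1 i).symm, fun i => (C.ac2 i).symm, fun i => (nd (C.du i) C.dc2).symm,
    fun i => (C.bc2 i).symm, fun i => (C'.bc2 i).symm, fun i j => (nd (C.du j) (C.da i)).symm,
    fun i j => (C.ba j i).symm, fun i j => (C'.ba j i).symm, fun i j => nd (C.du i) (C.db j),
    fun i j => nd (C.du i) (C.db' j), ?_, C.ainj, C.ui, ?_, ?_, ?_, ?_, ?_⟩
  · intro i j h
    have h3 := (C.Nb i (u i)).2 (Or.inl rfl)
    rw [h, C.Nb'] at h3
    rcases h3 with h3 | h3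
    · obtain rfl := C.ui _ _ h3
      exact C.bb' i h
    · exact h2 _ _ h3.symm
  · intro i j h
    have h3 := (C.Nb i (u i)).2 (Or.inl rfl)
    rw [h, C.Nb] at h3
    rcases h3 with h3 | h3
    · exact C.ui _ _ h3
    · exact absurd h3.symm (h1 _ _)
  · intro i j h
    have h3 := (C.Nb' i (u i)).2 (Or.inl rfl)
    rw [h, C.Nb'] at h3
    rcases h3 with h3 | h3
    · exact C.ui _ _ h3
    · exact absurd h3.symm (h2 _ _)
  · rintro (h | h | h | ⟨i, h | h | h | h⟩)
    · exact C.xv h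
    · exact nd C.dx C.dc1 h
    · exact nd C.dx C.dc2 h
    · exact nd C.dx (C.da i) h
    · exact C.xu i h
    · exact nd C.dx (C.db i) h
    · exact nd C.dx (C.db' i) h
  · rintro k (h | h | h | ⟨i, h | h | h | h⟩)
    · exact C.wv k h
    · exact nd (C.dw k) C.dc1 h
    · exact nd (C.dw k) C.dc2 h
    · exact nd (C.dw k) (C.da i) h
    · exact h1 k i h
    · exact nd (C.dw k) (C.db i) h
    · exact nd (C.dw k) (C.db' i) h
  · rintro k (h | h | h | ⟨i, h | h | h | h⟩)
    · exact C'.wv k h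
    · exact nd (C.dw' k) C.dc1 h
    · exact nd (C.dw' k) C.dc2 h
    · exact nd (C.dw' k) (C.da i) h
    · exact h2 k i h
    · exact nd (C.dw' k) (C.db i) h
    · exact nd (C.dw' k) (C.db' i) h

noncomputable def pick {V : Type} (f : Fin 3 → V) (c : Fin 3 → Fin 5) (z : V) : Fin 5 :=
  if z = f 0 then c 0 else if z = f 1 then c 1 else c 2

lemma pick_eq {V : Type} (f : Fin 3 → V) (c : Fin 3 → Fin 5) (hf : ∀ i j, f i = f j → i = j)
    (i : Fin 3) : pick f c (f i) = c i := by
  have h10 : f 1 ≠ f 0 := fun h => absurd (hf _ _ h) (by decide)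
  have h20 : f 2 ≠ f 0 := fun h => absurd (hf _ _ h) (by decide)
  have h21 : f 2 ≠ f 1 := fun h => absurd (hf _ _ h) (by decide)
  fin_cases i <;> simp [pick, h10, h20, h21]

/-- extending a colouring to the removed vertices -/
lemma ext_col {V : Type} [Fintype V] {G : SimpleGraph V} (hc : Critical52 G)
    {v c1 c2 x : V} {u a b b' w w' : Fin 3 → V}
    (C : Cfg G v c1 c2 x u a b b' w w') (D : Dist v c1 c2 x u a b b' w w')
    (φ : V → Fin 5)
    (hφ : ∀ p q, ¬ inD v c1 c2 u a b b' p → ¬ inD v c1 c2 u a b b' q → G.Adj p q → c5 (φ p) (φ q))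
    (t : Fin 5) (ht : t ≠ φ x) (hok : ∀ i, ok t (φ (w i)) (φ (w' i))) : False := by
  obtain ⟨d1, d2, hd1, hd2, hd3⟩ := three_step t (φ x) ht
  choose cu hu using hok
  choose ca hca using fun i => (hu i).1
  choose cb hcb using fun i => (hu i).2.1
  choose cb' hcb' using fun i => (hu i).2.2
  obtain ⟨ψ, hψ⟩ : ∃ ψ : V → Fin 5, ψ = fun z =>
    if z = v then t else if z = c1 then d1 else if z = c2 then d2 else
    if ∃ i, z = a i then pick a ca z else if ∃ i, z = u i then pick u cu z else
    if ∃ i, z = b i then pick b cb z else if ∃ i, z = b' i then pick b' cb' z else φ z := ⟨_, rfl⟩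
  have ev : ψ v = t := by simp [hψ]
  have ec1 : ψ c1 = d1 := by simp [hψ, D.vc1.symm]
  have ec2 : ψ c2 = d2 := by simp [hψ, D.vc2.symm, D.c12.symm]
  have ea : ∀ i, ψ (a i) = ca i := fun i => by
    simp [hψ, (D.va i).symm, (D.c1a i).symm, (D.c2a i).symm, pick_eq a ca D.ai]
  have eu : ∀ i, ψ (u i) = cu i := fun i => by
    simp [hψ, (D.vu i).symm, (D.c1u i).symm, (D.c2u i).symm, fun j => (D.au j i).symm,
      pick_eq u cu D.ui]
  have eb : ∀ i, ψ (b i) = cb i := fun i => by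
    simp [hψ, (D.vb i).symm, (D.c1b i).symm, (D.c2b i).symm, fun j => (D.ab j i).symm,
      fun j => (D.ub j i).symm, pick_eq b cb D.bi]
  have eb' : ∀ i, ψ (b' i) = cb' i := fun i => by
    simp [hψ, (D.vb' i).symm, (D.c1b' i).symm, (D.c2b' i).symm, fun j => (D.ab' j i).symm,
      fun j => (D.ub' j i).symm, fun j => (D.bb' j i).symm, pick_eq b' cb' D.bi']
  have eφ : ∀ z, ¬ inD v c1 c2 u a b b' z → ψ z = φ z := by
    intro z hz
    simp only [inD, not_or, not_exists] at hz
    obtain ⟨h1, h2, h3, h4⟩ := hz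
    simp [hψ, h1, h2, h3, fun i => (h4 i).1, fun i => (h4 i).2.1, fun i => (h4 i).2.2.1,
      fun i => (h4 i).2.2.2]
  have key : ∀ p q, inD v c1 c2 u a b b' p → G.Adj p q → c5 (ψ p) (ψ q) := by
    rintro p q (rfl | rfl | rfl | ⟨i, rfl | rfl | rfl | rfl⟩) hpq
    · rw [C.Nv] at hpq
      rcases hpq with rfl | ⟨i, rfl⟩
      · rw [ev, ec1]; exact hd1
      · rw [ev, ea]; exact (hca i).1
    · rw [C.Nc1] at hpq
      rcases hpq with rfl | rfl
      · rw [ev, ec1]; exact hd1.symm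
      · rw [ec1, ec2]; exact hd2
    · rw [C.Nc2] at hpq
      rcases hpq with rfl | rfl
      · rw [ec1, ec2]; exact hd2.symm
      · rw [ec2, eφ _ D.xD]; exact hd3
    · rw [C.Na] at hpq
      rcases hpq with rfl | rfl
      · rw [ev, ea]; exact (hca i).1.symm
      · rw [ea, eu]; exact (hca i).2
    · rw [C.Nu] at hpq
      rcases hpq with rfl | rfl | rfl
      · rw [ea, eu]; exact (hca i).2.symm
      · rw [eu, eb]; exact (hcb i).1
      · rw [eu, eb']; exact (hcb' i).1
    · rw [C.Nb] at hpq
      rcases hpq with rfl | rfl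
      · rw [eu, eb]; exact (hcb i).1.symm
      · rw [eb, eφ _ (D.wD i)]; exact (hcb i).2
    · rw [C.Nb'] at hpq
      rcases hpq with rfl | rfl
      · rw [eu, eb']; exact (hcb' i).1.symm
      · rw [eb', eφ _ (D.wD' i)]; exact (hcb' i).2
  refine not_PC hc ψ ?_
  intro p q hpq
  by_cases hp : inD v c1 c2 u a b b' p
  · exact key p q hp hpq
  by_cases hq : inD v c1 c2 u a b b' q
  · exact (key q p hq hpq.symm).symm
  rw [eφ p hp, eφ q hq]
  exact hφ p q hp hq hpq

/-- a vertex of a critical graph with at most two possible neighbours -/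
lemma deg2_transfer {m : ℕ} {W : SimpleGraph (Fin m)} (hW : Critical52 W) {X : Type} (i : Fin m → X)
    (hi : Function.Injective i) (k : Fin m) (P Q : X)
    (h : ∀ n, W.Adj k n → i n = P ∨ i n = Q) :
    ∃ kp kq, i kp = P ∧ i kq = Q ∧ W.Adj k kp ∧ W.Adj k kq ∧ kp ≠ kq ∧
      ∀ n, W.Adj k n → n = kp ∨ n = kq := by
  obtain ⟨n1, h1, _⟩ := exists_adj_ne hW k k
  obtain ⟨n2, h2, hne⟩ := exists_adj_ne hW k n1
  rcases h n1 h1 with e1 | e1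
  · have e2 : i n2 = Q := (h n2 h2).resolve_left (fun e => hne (hi (e.trans e1.symm)))
    refine ⟨n1, n2, e1, e2, h1, h2, hne.symm, fun n hn => ?_⟩
    rcases h n hn with e | e
    · exact Or.inl (hi (e.trans e1.symm))
    · exact Or.inr (hi (e.trans e2.symm))
  · have e2 : i n2 = P := (h n2 h2).resolve_right (fun e => hne (hi (e.trans e1.symm)))
    refine ⟨n2, n1, e2, e1, h2, h1, hne, fun n hn => ?_⟩
    rcases h n hn with e | e
    · exact Or.inl (hi (e.trans e2.symm))
    · exact Or.inr (hi (e.trans e1.symm))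

/-- no set of small potential avoids one special friend, its strings and the 2-string -/
lemma lemB' {V : Type} [Fintype V] {G : SimpleGraph V} (h : SmallestCex G)
    {v c1 c2 x : V} {u a b b' w w' : Fin 3 → V}
    (C : Cfg G v c1 c2 x u a b b' w w') (D : Dist v c1 c2 x u a b b' w w') (S : Finset V)
    (hS6 : 6 ≤ S.card) (hp : pS G S ≤ 5) (j : Fin 3) (hu : u j ∉ S) (ha : a j ∉ S) (hb : b j ∉ S)
    (hb' : b' j ∉ S) (hc1 : c1 ∉ S) (hc2 : c2 ∉ S) : False := by
  obtain ⟨m, W, i, φ, hi, hW, hE, hWK, hT⟩ := lemB h S hS6 hp (u j) (a j) (b j) (b' j) hu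
    ((C.Nu j _).2 (Or.inl rfl)) ((C.Nu j _).2 (Or.inr (Or.inl rfl)))
    ((C.Nu j _).2 (Or.inr (Or.inr rfl))) (C.ab j) (C.ab' j) (C.bb' j)
  obtain ⟨ku, hku⟩ := (hT _).1 hu
  obtain ⟨ka, hka⟩ := (hT _).1 ha
  obtain ⟨kb, hkb⟩ := (hT _).1 hb
  obtain ⟨kb', hkb'⟩ := (hT _).1 hb'
  obtain ⟨k1, hk1⟩ := (hT _).1 hc1
  obtain ⟨k2, hk2⟩ := (hT _).1 hc2
  have tr : ∀ (z p q : V) (k : Fin m), i k = Sum.inl z → (∀ n, G.Adj z n ↔ n = p ∨ n = q) →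
      ∃ kp kq, i kp = fS S φ p ∧ i kq = fS S φ q ∧ W.Adj k kp ∧ W.Adj k kq ∧ kp ≠ kq ∧
      ∀ n, W.Adj k n → n = kp ∨ n = kq := by
    intro z p q k hk hN
    apply deg2_transfer hW i hi
    intro n hn
    obtain ⟨s, t, h1, h2, h3⟩ := hWK _ _ hn
    rw [hk] at h2
    obtain ⟨rfl, _⟩ := fS_inl h2
    rw [hN] at h1
    rcases h1 with rfl | rfl
    · exact Or.inl h3.symm
    · exact Or.inr h3.symm
  have fo : ∀ z, z ∉ S → fS S φ z = Sum.inl z := fun z hz => by simp [fS, hz]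
  obtain ⟨kz, ku1, e1, e2, A1, A2, _, B1⟩ := tr _ _ _ ka hka (C.Na j)
  obtain ⟨ku2, _, e3, _, A3, _, _, B2⟩ := tr _ _ _ kb hkb (C.Nb j)
  obtain ⟨ku3, _, e4, _, A4, _, _, B3⟩ := tr _ _ _ kb' hkb' (C.Nb' j)
  obtain ⟨kz', k2', e5, e6, A5, A6, _, B4⟩ := tr _ _ _ k1 hk1 C.Nc1
  obtain ⟨_, _, _, _, _, _, _, B5⟩ := tr _ _ _ k2 hk2 C.Nc2
  obtain rfl : ku1 = ku := hi (by rw [e2, hku, fo _ hu])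
  obtain rfl : ku2 = ku1 := hi (by rw [e3, hku, fo _ hu])
  obtain rfl : ku3 = ku2 := hi (by rw [e4, hku, fo _ hu])
  obtain rfl : k2' = k2 := hi (by rw [e6, hk2, fo _ hc2])
  obtain rfl : kz' = kz := hi (by rw [e5, e1])
  have zne : ∀ y, v ≠ y → fS S φ v ≠ Sum.inl y := by
    intro y hy hh
    exact hy (fS_inl hh).1
  have inl_ne : ∀ {p q : V} {k l : Fin m}, i k = Sum.inl p → i l = Sum.inl q → p ≠ q → k ≠ l := by
    rintro p q k l h1 h2 h3 rfl
    rw [h1] at h2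
    exact h3 (Sum.inl.inj h2)
  have fin : ∀ E : SimpleGraph (Fin 10), Prop1 E → Nonempty (W ≃g E) → False := by
    rintro E hP ⟨e⟩
    have tr2 : ∀ k p q, (∀ n, W.Adj k n → n = p ∨ n = q) →
        ∃ p q, ∀ n, E.Adj (e k) n → n = p ∨ n = q := by
      intro k p q hk
      refine ⟨e p, e q, fun n hn => ?_⟩
      have h1 : W.Adj k (e.symm n) := by
        rw [← e.map_adj_iff]; simpa using hn
      rcases hk _ h1 with h2 | h2
      · left; rw [← h2]; simp
      · right; rw [← h2]; simp
    refine hP (e ku3) (e ka) (e kb) (e kb') (e kz') (e k1) (e k2') ?_ (e.map_adj_iff.2 A2.symm)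
      (e.map_adj_iff.2 A3.symm) (e.map_adj_iff.2 A4.symm) (e.injective.ne (inl_ne hka hkb (C.ab j)))
      (e.injective.ne (inl_ne hka hkb' (C.ab' j))) (e.injective.ne (inl_ne hkb hkb' (C.bb' j)))
      (e.map_adj_iff.2 A1) (e.injective.ne ?_) (e.map_adj_iff.2 A5.symm)
      (e.injective.ne (inl_ne hk1 hka (C.ca j))) (e.map_adj_iff.2 A6) (e.injective.ne ?_)
    · intro y hy
      simp only [List.mem_cons, List.not_mem_nil, or_false] at hy
      rcases hy with rfl | rfl | rfl | rfl | rfl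
      · exact tr2 _ _ _ B1
      · exact tr2 _ _ _ B2
      · exact tr2 _ _ _ B3
      · exact tr2 _ _ _ B4
      · exact tr2 _ _ _ B5
    · rintro rfl
      rw [hku] at e1
      exact zne _ (D.vu j) e1.symm
    · rintro rfl
      rw [hk2] at e1
      exact zne _ D.vc2 e1.symm
  rcases hE with hE | hE
  · exact fin _ prop1_E1 hE
  · exact fin _ prop1_E2 hE

end Pf

namespace Pf
open scoped Classical

/-- the reduced graph: delete `P`, add for each `j` a vertex joined to both ends -/
def KK {V : Type} (G : SimpleGraph V) (P : V → Prop) (w w' : Fin 3 → V) :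
    SimpleGraph (V ⊕ Fin 3) where
  Adj s t := match s, t with
    | Sum.inl p, Sum.inl q => ¬ P p ∧ ¬ P q ∧ G.Adj p q
    | Sum.inl p, Sum.inr j => p = w j ∨ p = w' j
    | Sum.inr j, Sum.inl p => p = w j ∨ p = w' j
    | Sum.inr _, Sum.inr _ => False
  symm := ⟨by
    rintro (p | p) (q | q) h
    · exact ⟨h.2.1, h.1, h.2.2.symm⟩
    · exact h
    · exact h
    · exact h⟩
  loopless := ⟨by
    rintro (p | p) h
    · exact h.2.2.ne rfl
    · exact h⟩

lemma KK_count {V : Type} [Fintype V] {G : SimpleGraph V} {P : V → Prop} {w w' : Fin 3 → V}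
    {m : ℕ} {W : SimpleGraph (Fin m)} {i : Fin m → V ⊕ Fin 3} (hi : Function.Injective i)
    (hWK : ∀ a b, W.Adj a b → (KK G P w w').Adj (i a) (i b)) (R : Finset V) (J : Finset (Fin 3))
    (hR : ∀ p, p ∈ R ↔ ∃ k, i k = Sum.inl p) (hJ : ∀ j, j ∈ J ↔ ∃ k, i k = Sum.inr j)
    (T : Finset (Sym2 V))
    (hT : ∀ a b p q, W.Adj a b → i a = Sum.inl p → i b = Sum.inl q → s(p, q) ∈ T) :
    m = R.card + J.card ∧ (ES W Finset.univ).card ≤ T.card + 2 * J.card := by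
  constructor
  · have h1 : Finset.univ.image i = R.disjSum J := by
      ext z
      rcases z with p | p
      · simp [hR]
      · simp [hJ]
    have h2 := congrArg Finset.card h1
    rw [Finset.card_image_of_injective _ hi, Finset.card_disjSum] at h2
    simpa using h2
  · have hinj : Function.Injective (Sym2.map i) := Sym2.map.injective hi
    have h1 : (ES W Finset.univ).image (Sym2.map i) ⊆
        T.image (Sym2.map Sum.inl) ∪ (J.image (fun j => s(Sum.inl (w j), Sum.inr j)) ∪
          J.image (fun j => s(Sum.inl (w' j), Sum.inr j))) := by
      intro e he
      obtain ⟨e, he', rfl⟩ := Finset.mem_image.1 he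
      induction e using Sym2.ind with
      | _ a b =>
      rw [mem_ES] at he'
      have hab := he'.1
      have hK := hWK _ _ hab
      have : ∀ a b p j, W.Adj a b → i a = Sum.inl p → i b = Sum.inr j →
          s(i a, i b) ∈ (J.image (fun j => s(Sum.inl (w j), Sum.inr j)) ∪
          J.image (fun j => s(Sum.inl (w' j), Sum.inr j)) : Finset (Sym2 (V ⊕ Fin 3))) := by
        intro a b p j hab ha hb
        have hK := hWK _ _ hab
        have hj : j ∈ J := (hJ j).2 ⟨b, hb⟩
        rw [ha, hb] at hK ⊢
        rcases hK with rfl | rfl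
        · exact Finset.mem_union_left _ (Finset.mem_image_of_mem _ hj)
        · exact Finset.mem_union_right _ (Finset.mem_image_of_mem (fun j => s(Sum.inl (w' j), Sum.inr j)) hj)
      rw [Sym2.map_mk]
      rcases ha : i a with p | p <;> rcases hb : i b with q | q
      · apply Finset.mem_union_left
        exact Finset.mem_image.2 ⟨s(p, q), hT _ _ _ _ hab ha hb, rfl⟩
      · apply Finset.mem_union_right
        rw [← ha, ← hb]
        exact this a b p q hab ha hb
      · apply Finset.mem_union_right
        have := this b a q p hab.symm hb ha
        rw [hb, ha] at this
        rwa [Sym2.eq_swap]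
      · rw [ha, hb] at hK; exact hK.elim
    have h2 := Finset.card_le_card h1
    rw [Finset.card_image_of_injective _ hinj] at h2
    have h3 := Finset.card_union_le (T.image (Sym2.map Sum.inl)) (J.image (fun j => (s(Sum.inl (w j), Sum.inr j) : Sym2 (V ⊕ Fin 3))) ∪
          J.image (fun j => s(Sum.inl (w' j), Sum.inr j)))
    have h4 := Finset.card_union_le (J.image (fun j => (s(Sum.inl (w j), Sum.inr j) : Sym2 (V ⊕ Fin 3)))) (
          J.image (fun j => s(Sum.inl (w' j), Sum.inr j)))
    have h5 : (T.image (Sym2.map (Sum.inl : V → V ⊕ Fin 3))).card ≤ T.card := Finset.card_image_le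
    have h6 : (J.image (fun j => (s(Sum.inl (w j), Sum.inr j) : Sym2 (V ⊕ Fin 3)))).card ≤ J.card := Finset.card_image_le
    have h7 : (J.image (fun j => (s(Sum.inl (w' j), Sum.inr j) : Sym2 (V ⊕ Fin 3)))).card ≤ J.card := Finset.card_image_le
    omega

lemma KK_nohom {V : Type} [Fintype V] {G : SimpleGraph V} (hc : Critical52 G)
    {v c1 c2 x : V} {u a b b' w w' : Fin 3 → V}
    (C : Cfg G v c1 c2 x u a b b' w w') (D : Dist v c1 c2 x u a b b' w w') :
    IsEmpty (KK G (inD v c1 c2 u a b b') w w' →g cycleGraph 5) := by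
  refine ⟨fun g => ?_⟩
  have hf : ∀ j, ∃ f, ∀ t, t ≠ f → ok t (g (Sum.inl (w j))) (g (Sum.inl (w' j))) := by
    intro j
    refine ok_forbid _ _ (g (Sum.inr j)) ?_ ?_
    · exact g.map_rel (a := Sum.inr j) (b := Sum.inl (w j)) (Or.inl rfl)
    · exact g.map_rel (a := Sum.inr j) (b := Sum.inl (w' j)) (Or.inr rfl)
  choose f hf using hf
  obtain ⟨t, h0, h1, h2, h3⟩ := avoid4 (f 0) (f 1) (f 2) (g (Sum.inl x))
  refine ext_col hc C D (fun p => g (Sum.inl p)) ?_ t h3 ?_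
  · intro p q hp hq hpq
    exact g.map_rel (a := Sum.inl p) (b := Sum.inl q) ⟨hp, hq, hpq⟩
  · intro j
    apply hf
    fin_cases j <;> assumption

/-- adding a special friend -/
noncomputable def addF {V : Type} (u a b b' : Fin 3 → V) (j : Fin 3) (S : Finset V) : Finset V :=
  insert (a j) (insert (u j) (insert (b' j) (insert (b j) S)))

lemma mem_addF {V : Type} (u a b b' : Fin 3 → V) (j : Fin 3) (S : Finset V) (z : V) :
    z ∈ addF u a b b' j S ↔ z ∈ S ∨ z = a j ∨ z = u j ∨ z = b j ∨ z = b' j := by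
  simp only [addF, Finset.mem_insert]; tauto

lemma pS_addF {V : Type} [Fintype V] {G : SimpleGraph V}
    {v c1 c2 x : V} {u a b b' w w' : Fin 3 → V}
    (C : Cfg G v c1 c2 x u a b b' w w') (D : Dist v c1 c2 x u a b b' w w') (j : Fin 3)
    (S : Finset V) (hw : w j ∈ S) (hw' : w' j ∈ S) (ha : a j ∉ S) (hu : u j ∉ S) (hb : b j ∉ S)
    (hb' : b' j ∉ S) : pS G (addF u a b b' j S) ≤ pS G S := by
  have h1 : pS G (insert (b j) S) ≤ pS G S + 1 := pS_ins1 hb hw ((C.Nb j _).2 (Or.inr rfl))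
  have h2 : pS G (insert (b' j) (insert (b j) S)) ≤ pS G (insert (b j) S) + 1 :=
    pS_ins1 (by simp [hb', (D.bb' j j).symm]) (by simp [hw']) ((C.Nb' j _).2 (Or.inr rfl))
  have h3 : pS G (insert (u j) (insert (b' j) (insert (b j) S))) ≤
      pS G (insert (b' j) (insert (b j) S)) - 3 :=
    pS_ins2 (n := b j) (n' := b' j) (by simp [hu, D.ub, D.ub']) (D.bb' j j) (by simp) (by simp)
      ((C.Nu j _).2 (by simp)) ((C.Nu j _).2 (by simp))
  have h4 : pS G (addF u a b b' j S) ≤ pS G (insert (u j) (insert (b' j) (insert (b j) S))) + 1 :=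
    pS_ins1 (n := u j) (by simp [ha, D.au, D.ab, D.ab']) (by simp) ((C.Na j _).2 (by simp))
  linarith

end Pf

namespace Pf
open scoped Classical

lemma three_nbrs {V : Type} [Fintype V] {G : SimpleGraph V} {z : V} (h : 3 ≤ deg G z) :
    ∃ n1 n2 n3, G.Adj z n1 ∧ G.Adj z n2 ∧ G.Adj z n3 ∧ n1 ≠ n2 ∧ n1 ≠ n3 ∧ n2 ≠ n3 := by
  have h2 : 2 < (G.neighborSet z).ncard := h
  rw [Set.two_lt_ncard_iff] at h2
  obtain ⟨n1, n2, n3, h1, h2, h3, h4, h5, h6⟩ := h2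
  exact ⟨n1, n2, n3, h1, h2, h3, h4, h5, h6⟩

lemma ex3 (P : Fin 3 → Prop) : (∃ j, P j) ↔ P 0 ∨ P 1 ∨ P 2 := by
  simp [Fin.exists_fin_succ]

lemma third : ∀ i j : Fin 3, i ≠ j → ∃ k, k ≠ i ∧ k ≠ j ∧ ∀ l, l = i ∨ l = j ∨ l = k := by decide

set_option maxHeartbeats 4000000 in
lemma noncoin {V : Type} [Fintype V] {G : SimpleGraph V} (h : SmallestCex G)
    {v c1 c2 x : V} {u a b b' w w' : Fin 3 → V}
    (C : Cfg G v c1 c2 x u a b b' w w') (D : Dist v c1 c2 x u a b b' w w')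
    (hw : ∀ i, ¬ G.Adj (w i) (w' i)) : False := by
  have hc : Critical52 G := h.1
  obtain ⟨m, W, i, hi, hWK, hW⟩ := exists_crit _ (KK_nohom hc C D)
  obtain ⟨R, hR⟩ : ∃ R : Finset V, ∀ p, p ∈ R ↔ ∃ k, i k = Sum.inl p :=
    ⟨Finset.univ.filter (fun p => ∃ k, i k = Sum.inl p), by simp⟩
  obtain ⟨J, hJ⟩ : ∃ J : Finset (Fin 3), ∀ p, p ∈ J ↔ ∃ k, i k = Sum.inr p :=
    ⟨Finset.univ.filter (fun p => ∃ k, i k = Sum.inr p), by simp⟩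
  -- transfer of degree two vertices
  have tr : ∀ j k, i k = Sum.inr j → ∃ kp kq, i kp = Sum.inl (w j) ∧ i kq = Sum.inl (w' j) ∧
      W.Adj k kp ∧ W.Adj k kq ∧ kp ≠ kq ∧ ∀ n, W.Adj k n → n = kp ∨ n = kq := by
    intro j k hk
    apply deg2_transfer hW i hi
    intro n hn
    have := hWK _ _ hn
    rw [hk] at this
    rcases hin : i n with p | p
    · rw [hin] at this
      rcases this with rfl | rfl
      · exact Or.inl rfl
      · exact Or.inr rfl
    · rw [hin] at this; exact this.elim
  have hwR : ∀ j ∈ J, w j ∈ R ∧ w' j ∈ R := by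
    intro j hj
    obtain ⟨k, hk⟩ := (hJ j).1 hj
    obtain ⟨kp, kq, h1, h2, _⟩ := tr j k hk
    exact ⟨(hR _).2 ⟨kp, h1⟩, (hR _).2 ⟨kq, h2⟩⟩
  have hRD : ∀ p ∈ R, ¬ inD v c1 c2 u a b b' p := by
    intro p hp
    obtain ⟨k, hk⟩ := (hR p).1 hp
    obtain ⟨n, hn, _⟩ := exists_adj_ne hW k k
    have := hWK _ _ hn
    rw [hk] at this
    rcases hin : i n with q | q
    · rw [hin] at this; exact this.1
    · rw [hin] at this
      rcases this with rfl | rfl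
      · exact D.wD _
      · exact D.wD' _
  have nR : ∀ p, inD v c1 c2 u a b b' p → p ∉ R := fun p hp hh => hRD p hh hp
  have vR : v ∉ R := nR _ (Or.inl rfl)
  have c1R : c1 ∉ R := nR _ (Or.inr (Or.inl rfl))
  have c2R : c2 ∉ R := nR _ (Or.inr (Or.inr (Or.inl rfl)))
  have aR : ∀ j, a j ∉ R := fun j => nR _ (Or.inr (Or.inr (Or.inr ⟨j, by simp⟩)))
  have uR : ∀ j, u j ∉ R := fun j => nR _ (Or.inr (Or.inr (Or.inr ⟨j, by simp⟩)))
  have bR : ∀ j, b j ∉ R := fun j => nR _ (Or.inr (Or.inr (Or.inr ⟨j, by simp⟩)))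
  have bR' : ∀ j, b' j ∉ R := fun j => nR _ (Or.inr (Or.inr (Or.inr ⟨j, by simp⟩)))
  have a01 : a 0 ≠ a 1 := fun hh => absurd (D.ai _ _ hh) (by decide)
  have a02 : a 0 ≠ a 2 := fun hh => absurd (D.ai _ _ hh) (by decide)
  have a12 : a 1 ≠ a 2 := fun hh => absurd (D.ai _ _ hh) (by decide)
  have hTG : ∀ k l p q, W.Adj k l → i k = Sum.inl p → i l = Sum.inl q → G.Adj p q := by
    intro k l p q hkl hk hl
    have := hWK _ _ hkl
    rw [hk, hl] at this
    exact this.2.2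
  have hTE : ∀ k l p q, W.Adj k l → i k = Sum.inl p → i l = Sum.inl q → s(p, q) ∈ ES G R := by
    intro k l p q hkl hk hl
    rw [mem_ES]
    exact ⟨hTG k l p q hkl hk hl, (hR _).2 ⟨k, hk⟩, (hR _).2 ⟨l, hl⟩⟩
  obtain ⟨hm, hE⟩ := KK_count hi hWK R J hR hJ (ES G R) hTE
  have hJ3 : J.card ≤ 3 := by simpa using Finset.card_le_univ J
  have hmV : m < Fintype.card V := by
    have h1 : (insert v (insert (a 0) (insert (a 1) (insert (a 2) R)))).card = R.card + 4 := by
      rw [Finset.card_insert_of_notMem, Finset.card_insert_of_notMem, Finset.card_insert_of_notMem,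
        Finset.card_insert_of_notMem]
      · simp [aR]
      · simp [aR, a12]
      · simp [aR, a01, a02]
      · simp [vR, D.va]
    have h2 := Finset.card_le_univ (insert v (insert (a 0) (insert (a 1) (insert (a 2) R))))
    omega
  have hpR : pS G R ≤ pot W + 3 * J.card := by
    rw [pot_eq]
    simp only [pS, Finset.card_univ, Fintype.card_fin]
    omega
  have avc : G.Adj v c1 := (C.Nv _).2 (Or.inl rfl)
  have ava : ∀ j, G.Adj v (a j) := fun j => (C.Nv _).2 (Or.inr ⟨j, rfl⟩)
  -- C3 with two new vertices is impossible
  have noC3 : ∀ j j', j ∈ J → j' ∈ J → j ≠ j' → Nonempty (W ≃g cycleGraph 3) → False := by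
    rintro j j' hj hj' hne ⟨e⟩
    obtain ⟨k, hk⟩ := (hJ j).1 hj
    obtain ⟨k', hk'⟩ := (hJ j').1 hj'
    have hkk : k ≠ k' := by
      rintro rfl
      rw [hk] at hk'; exact hne (Sum.inr.inj hk')
    have : W.Adj k k' := by
      rw [← e.map_adj_iff]
      have : ∀ s t : Fin 3, s ≠ t → (cycleGraph 3).Adj s t := by decide
      exact this _ _ (e.injective.ne hkk)
    have := hWK _ _ this
    rw [hk, hk'] at this
    exact this
  have hcases := cex_cases' h W hW hmV
  rcases Nat.lt_or_ge J.card 1 with hJ0 | hJ1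
  · -- J empty
    have hJ0 : J = ∅ := by rw [← Finset.card_eq_zero]; omega
    obtain ⟨φ, hφ⟩ := exists_PC hc R (fun hh => vR (hh ▸ Finset.mem_univ v))
    refine not_PC hW (fun k => Sum.elim φ (fun _ => 0) (i k)) ?_
    intro k l hkl
    have no : ∀ k j, i k ≠ Sum.inr j := by
      intro k j hk
      have := (hJ j).2 ⟨k, hk⟩
      simp [hJ0] at this
    rcases hk : i k with p | p
    · rcases hl : i l with q | q
      · simp only [hk, hl, Sum.elim_inl]
        exact hφ p ((hR _).2 ⟨k, hk⟩) q ((hR _).2 ⟨l, hl⟩) (hTG _ _ _ _ hkl hk hl)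
      · exact absurd hl (no _ _)
    · exact absurd hk (no _ _)
  rcases Nat.lt_or_ge J.card 2 with hJ1' | hJ2
  · obtain ⟨j, rfl⟩ : ∃ j, J = {j} := Finset.card_eq_one.1 (by omega)
    have hne : R.Nonempty := ⟨w j, (hwR j (by simp)).1⟩
    simp only [Finset.card_singleton] at *
    rcases hcases with hp | ⟨⟨e⟩, _, _⟩ | ⟨hEE, hp, hm10⟩
    · exact lemA h R hne (by push_cast at hpR; linarith) v c1 (a 0) (a 1) vR avc (ava 0) (ava 1) (C.ca 0) (C.ca 1) a01
    · obtain ⟨k, hk⟩ := (hJ j).1 (by simp)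
      obtain ⟨kp, kq, h1, h2, _, _, h3, _⟩ := tr j k hk
      have : W.Adj kp kq := by
        rw [← e.map_adj_iff]
        have : ∀ s t : Fin 3, s ≠ t → (cycleGraph 3).Adj s t := by decide
        exact this _ _ (e.injective.ne h3)
      exact hw j (hTG _ _ _ _ this h1 h2)
    · exact lemB' h C D R (by omega) (by push_cast at hpR; linarith) 0 (uR 0) (aR 0) (bR 0) (bR' 0) c1R c2R
  rcases Nat.lt_or_ge J.card 3 with hJ2' | hJ3'
  · obtain ⟨j, l, hjl, rfl⟩ : ∃ j l, j ≠ l ∧ J = {j, l} := Finset.card_eq_two.1 (by omega)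
    rw [Finset.card_pair hjl] at hpR hm
    obtain ⟨k, hkj, hkl, _⟩ := third j l hjl
    obtain ⟨wj, wj'⟩ := hwR j (by simp)
    obtain ⟨wl, wl'⟩ := hwR l (by simp)
    have s1 := pS_addF C D j R wj wj' (aR j) (uR j) (bR j) (bR' j)
    have nlj := fun (f : Fin 3 → V) (hf : ∀ i j, f i = f j → i = j) (hh : f l = f j) => hjl (hf _ _ hh).symm
    have nkj := fun (f : Fin 3 → V) (hf : ∀ i j, f i = f j → i = j) (hh : f k = f j) => hkj (hf _ _ hh)
    have nkl := fun (f : Fin 3 → V) (hf : ∀ i j, f i = f j → i = j) (hh : f k = f l) => hkl (hf _ _ hh)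
    have s2 := pS_addF C D l (addF u a b b' j R) (by simp [mem_addF, wl]) (by simp [mem_addF, wl'])
      (by simp [mem_addF, aR, D.au, D.ab, D.ab']; exact nlj a D.ai)
      (by simp [mem_addF, uR, (D.au _ _).symm, D.ub, D.ub']; exact nlj u D.ui)
      (by simp [mem_addF, bR, (D.ab _ _).symm, (D.ub _ _).symm, D.bb']; exact nlj b D.bi)
      (by simp [mem_addF, bR', (D.ab' _ _).symm, (D.ub' _ _).symm, (D.bb' _ _).symm]; exact nlj b' D.bi')
    obtain ⟨S, hS⟩ : ∃ S, S = addF u a b b' l (addF u a b b' j R) := ⟨_, rfl⟩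
    rw [← hS] at s2
    have memS : ∀ z, z ∈ S ↔ (z ∈ R ∨ z = a j ∨ z = u j ∨ z = b j ∨ z = b' j) ∨ z = a l ∨ z = u l ∨ z = b l ∨ z = b' l := by
      intro z; rw [hS, mem_addF, mem_addF]
    have vS : v ∉ S := by simp [memS, vR, D.va, D.vu, D.vb, D.vb']
    have s3 : pS G (insert v S) ≤ pS G S - 3 := pS_ins2 (n := a j) (n' := a l) vS (fun hh => hjl (D.ai _ _ hh))
      (by simp [memS]) (by simp [memS]) (ava j) (ava l)
    have uS : u k ∉ insert v S := by
      simp [memS, uR, (D.au _ _).symm, D.ub, D.ub', (D.vu _).symm]; exact ⟨nkj u D.ui, nkl u D.ui⟩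
    rcases hcases with hp | ⟨hC3, _, _⟩ | ⟨hEE, hp, hm10⟩
    · exact lemA h (insert v S) ⟨v, by simp⟩ (by push_cast at hpR; linarith) (u k) (a k) (b k) (b' k) uS ((C.Nu k _).2 (by simp)) ((C.Nu k _).2 (by simp))
        ((C.Nu k _).2 (by simp)) (D.ab _ _) (D.ab' _ _) (D.bb' _ _)
    · exact noC3 j l (by simp) (by simp) hjl hC3
    · refine lemB' h C D (insert v S) ?_ (by push_cast at hpR; linarith) k uS ?_ ?_ ?_ ?_ ?_
      · have : R ⊆ insert v S := fun z hz => by simp [memS, hz]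
        have := Finset.card_le_card this
        omega
      · simp [memS, aR, D.au, D.ab, D.ab', (D.va _).symm]; exact ⟨nkj a D.ai, nkl a D.ai⟩
      · simp [memS, bR, (D.ab _ _).symm, (D.ub _ _).symm, D.bb', (D.vb _).symm]; exact ⟨nkj b D.bi, nkl b D.bi⟩
      · simp [memS, bR', (D.ab' _ _).symm, (D.ub' _ _).symm, (D.bb' _ _).symm, (D.vb' _).symm]; exact ⟨nkj b' D.bi', nkl b' D.bi'⟩
      · simp [memS, c1R, D.vc1.symm, D.c1a, D.c1u, D.c1b, D.c1b']
      · simp [memS, c2R, D.vc2.symm, D.c2a, D.c2u, D.c2b, D.c2b']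
  have hJu : J = Finset.univ := by
    rw [← Finset.card_eq_iff_eq_univ]; simp; omega
  have hJc : J.card = 3 := by omega
  have inJ : ∀ j, j ∈ J := by simp [hJu]
  rw [hJc] at hpR hm
  have n10 : ∀ (f : Fin 3 → V) (hf : ∀ i j, f i = f j → i = j), f 1 ≠ f 0 := fun f hf hh => absurd (hf _ _ hh) (by decide)
  have n20 : ∀ (f : Fin 3 → V) (hf : ∀ i j, f i = f j → i = j), f 2 ≠ f 0 := fun f hf hh => absurd (hf _ _ hh) (by decide)
  have n21 : ∀ (f : Fin 3 → V) (hf : ∀ i j, f i = f j → i = j), f 2 ≠ f 1 := fun f hf hh => absurd (hf _ _ hh) (by decide)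
  have s0 := pS_addF C D 0 R (hwR _ (inJ _)).1 (hwR _ (inJ _)).2 (aR _) (uR _) (bR _) (bR' _)
  have s1 := pS_addF C D 1 (addF u a b b' 0 R) (by simp [mem_addF, hwR _ (inJ 1)]) (by simp [mem_addF, hwR _ (inJ 1)])
      (by simp [mem_addF, aR, D.au, D.ab, D.ab']; exact n10 a D.ai)
      (by simp [mem_addF, uR, (D.au _ _).symm, D.ub, D.ub']; exact n10 u D.ui)
      (by simp [mem_addF, bR, (D.ab _ _).symm, (D.ub _ _).symm, D.bb']; exact n10 b D.bi)
      (by simp [mem_addF, bR', (D.ab' _ _).symm, (D.ub' _ _).symm, (D.bb' _ _).symm]; exact n10 b' D.bi')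
  have s2 := pS_addF C D 2 (addF u a b b' 1 (addF u a b b' 0 R)) (by simp [mem_addF, hwR _ (inJ 2)]) (by simp [mem_addF, hwR _ (inJ 2)])
      (by simp [mem_addF, aR, D.au, D.ab, D.ab']; exact ⟨n20 a D.ai, n21 a D.ai⟩)
      (by simp [mem_addF, uR, (D.au _ _).symm, D.ub, D.ub']; exact ⟨n20 u D.ui, n21 u D.ui⟩)
      (by simp [mem_addF, bR, (D.ab _ _).symm, (D.ub _ _).symm, D.bb']; exact ⟨n20 b D.bi, n21 b D.bi⟩)
      (by simp [mem_addF, bR', (D.ab' _ _).symm, (D.ub' _ _).symm, (D.bb' _ _).symm]; exact ⟨n20 b' D.bi', n21 b' D.bi'⟩)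
  obtain ⟨S, hS⟩ : ∃ S, S = addF u a b b' 2 (addF u a b b' 1 (addF u a b b' 0 R)) := ⟨_, rfl⟩
  rw [← hS] at s2
  have memS : ∀ z, z ∈ S ↔ z ∈ R ∨ ∃ j, z = a j ∨ z = u j ∨ z = b j ∨ z = b' j := by
    intro z; rw [hS, mem_addF, mem_addF, mem_addF, ex3]; simp only [or_assoc]
  have vS : v ∉ S := by simp [memS, vR, D.va, D.vu, D.vb, D.vb']
  have s3 : pS G (insert v S) ≤ pS G S - 7 := pS_ins3 (n := a 0) (n' := a 1) (n'' := a 2) vS a01 a02 a12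
    ((memS _).2 (Or.inr ⟨0, by simp⟩)) ((memS _).2 (Or.inr ⟨1, by simp⟩)) ((memS _).2 (Or.inr ⟨2, by simp⟩)) (ava 0) (ava 1) (ava 2)
  have hp2 : pot W ≤ 2 := by
    rcases hcases with hp | ⟨hC3, _, _⟩ | ⟨hEE, hp, hm10⟩
    · linarith
    · exact (noC3 0 1 (inJ _) (inJ _) (by decide) hC3).elim
    · linarith
  push_cast at hpR
  by_cases hxR : x ∈ R
  swap
  · obtain ⟨n1, n2, n3, h1, h2, h3, h4, h5, h6⟩ := three_nbrs C.dx
    refine lemA h (insert v S) ⟨v, by simp⟩ (by linarith) x n1 n2 n3 ?_ h1 h2 h3 h4 h5 h6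
    have := D.xD
    simp only [inD, not_or] at this
    simp only [Finset.mem_insert, memS, not_or]
    exact ⟨this.1, hxR, this.2.2.2⟩
  -- x in R
  have s4 : pS G (insert c1 (insert v S)) ≤ pS G (insert v S) + 1 :=
    pS_ins1 (n := v) (by simp [memS, c1R, D.vc1.symm, D.c1a, D.c1u, D.c1b, D.c1b']) (by simp) ((C.Nc1 _).2 (by simp))
  have s5 : pS G (insert c2 (insert c1 (insert v S))) ≤ pS G (insert c1 (insert v S)) - 3 :=
    pS_ins2 (n := c1) (n' := x) (by simp [memS, c2R, D.vc2.symm, D.c12.symm, D.c2a, D.c2u, D.c2b, D.c2b'])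
      (fun hh => D.xD (by rw [← hh]; exact Or.inr (Or.inl rfl))) (by simp) (by simp [memS, hxR])
      ((C.Nc2 _).2 (by simp)) ((C.Nc2 _).2 (by simp))
  have hge : ∀ T : Finset V, T.Nonempty → 2 ≤ pS G T := by
    intro T hT
    by_cases hu : T = Finset.univ
    · rw [hu]; exact pS_univ_ge h
    · have := lemA0' h T hT hu; linarith
  have hfull : insert c2 (insert c1 (insert v S)) = Finset.univ := by
    by_contra hne
    have := lemA0' h _ ⟨c2, by simp⟩ hne
    linarith
  have hge2 := pS_univ_ge h
  rw [hfull] at s5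
  have hRc : ∀ z, z ∈ R ↔ ¬ inD v c1 c2 u a b b' z := by
    intro z
    refine ⟨hRD z, fun hz => ?_⟩
    have : z ∈ insert c2 (insert c1 (insert v S)) := by rw [hfull]; simp
    simp only [Finset.mem_insert, memS] at this
    simp only [inD, not_or] at hz
    exact (((this.resolve_left hz.2.2.1).resolve_left hz.2.1).resolve_left hz.1).resolve_right
      hz.2.2.2
  rcases hcases with hp | ⟨hC3, _, _⟩ | ⟨hEE, hp, hm10⟩
  · linarith
  · exact noC3 0 1 (inJ _) (inJ _) (by decide) hC3
  -- every edge comes from W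
  have hback : ∀ k l p q, i k = Sum.inl p → i l = Sum.inl q → G.Adj p q → W.Adj k l := by
    intro k l p q hk hl hpq
    by_contra hn
    obtain ⟨_, hE2⟩ := KK_count hi hWK R J hR hJ ((ES G R).erase s(p, q)) (by
      intro k' l' p' q' hkl hk' hl'
      refine Finset.mem_erase.2 ⟨?_, hTE _ _ _ _ hkl hk' hl'⟩
      intro hh
      rw [Sym2.eq_iff] at hh
      rcases hh with ⟨rfl, rfl⟩ | ⟨rfl, rfl⟩
      · rw [hi (hk'.trans hk.symm), hi (hl'.trans hl.symm)] at hkl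
        exact hn hkl
      · rw [hi (hk'.trans hl.symm), hi (hl'.trans hk.symm)] at hkl
        exact hn hkl.symm)
    have hmem : s(p, q) ∈ ES G R := (mem_ES _ _ _ _).2 ⟨hpq, (hR _).2 ⟨k, hk⟩, (hR _).2 ⟨l, hl⟩⟩
    rw [Finset.card_erase_of_mem hmem] at hE2
    have hpos : 0 < (ES G R).card := Finset.card_pos.2 ⟨_, hmem⟩
    have : pS G R ≤ pot W + 5 := by
      rw [pot_eq]
      simp only [pS, Finset.card_univ, Fintype.card_fin]
      omega
    linarith
  choose y hy using fun j => (hJ j).1 (inJ j)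
  choose g g' hg hg' ag ag' gg gall using fun j => tr j (y j) (hy j)
  obtain ⟨kx, hkx⟩ := (hR x).1 hxR
  have fin : ∀ E : SimpleGraph (Fin 10), Prop2 E → Nonempty (W ≃g E) → False := by
    rintro E hP ⟨e⟩
    obtain ⟨ρ, t, r1, r2, r3⟩ := hP (fun j => e (y j)) (fun j => e (g j)) (fun j => e (g' j)) (e kx)
      (by
        intro j n hn
        have h1 : W.Adj (y j) (e.symm n) := by
          rw [← e.map_adj_iff]; simpa using hn
        rcases gall j _ h1 with h2 | h2
        · left; rw [← h2]; simp
        · right; rw [← h2]; simp)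
      (fun j => e.map_adj_iff.2 (ag j)) (fun j => e.map_adj_iff.2 (ag' j))
      (fun j => e.injective.ne (gg j))
      (by
        intro j l hjl
        have h1 := e.injective hjl
        have h2 := hy j
        rw [h1, hy l] at h2
        exact (Sum.inr.inj h2).symm)
      (by
        intro j l hjl
        rw [e.map_adj_iff] at hjl
        have := hWK _ _ hjl
        rw [hy, hy] at this
        exact this)
      (by
        intro j hj
        have := e.injective hj
        rw [this, hy] at hkx
        cases hkx)
    obtain ⟨κ, hκ⟩ : ∃ κ : V → Fin m, ∀ p ∈ R, i (κ p) = Sum.inl p := by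
      refine ⟨fun p => if hp : ∃ k, i k = Sum.inl p then hp.choose else kx, fun p hp => ?_⟩
      have := (hR p).1 hp
      simp only [this, dif_pos]
      exact this.choose_spec
    have κe : ∀ k p, i k = Sum.inl p → κ p = k := fun k p hk => hi ((hκ p ((hR p).2 ⟨k, hk⟩)).trans hk.symm)
    have ney : ∀ p ∈ R, ∀ j, e (κ p) ≠ e (y j) := by
      intro p hp j hh
      have h1 := hκ p hp
      rw [e.injective hh, hy] at h1
      cases h1
    refine ext_col hc C D (fun p => ρ (e (κ p))) ?_ t ?_ ?_
    · intro p q hp hq hpq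
      have hp := (hRc p).2 hp
      have hq := (hRc q).2 hq
      exact r1 _ _ (e.map_adj_iff.2 (hback _ _ p q (hκ p hp) (hκ q hq) hpq)) (ney p hp) (ney q hq)
    · simpa [κe kx x hkx] using r2
    · intro j
      have := r3 j
      simpa [κe _ _ (hg j), κe _ _ (hg' j)] using this
  rcases hEE with hE | hE
  · exact fin _ prop2_E1 hE
  · exact fin _ prop2_E2 hE

end Pf

namespace Pf
open scoped Classical

set_option maxHeartbeats 2000000 in
lemma coin0 {V : Type} [Fintype V] {G : SimpleGraph V} (h : SmallestCex G)
    {v c1 c2 x : V} {u a b b' w w' : Fin 3 → V}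
    (C : Cfg G v c1 c2 x u a b b' w w') (i j : Fin 3) (hne : i ≠ j) (hb : b i = b j)
    (hw : w i = u j) : False := by
  have hc : Critical52 G := h.1
  have C' : Cfg G v c1 c2 x u a b' b w' w := by
    have := C.swap (fun _ => true)
    simpa using this
  have nd : ∀ {p q : V}, 3 ≤ deg G p → deg G q = 2 → p ≠ q := fun h1 h2 => Cfg.ne_of_deg h1 h2
  have avc : G.Adj v c1 := (C.Nv _).2 (Or.inl rfl)
  have ava : ∀ j, G.Adj v (a j) := fun j => (C.Nv _).2 (Or.inr ⟨j, rfl⟩)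
  have uij : u i ≠ u j := fun hh => hne (C.ui _ _ hh)
  have Ai : G.Adj (b i) (u i) := (C.Nb i _).2 (Or.inl rfl)
  have Aj : G.Adj (b i) (u j) := by rw [hb]; exact (C.Nb j _).2 (Or.inl rfl)
  have Di : G.Adj (b' i) (u i) := (C.Nb' i _).2 (Or.inl rfl)
  have Dj : G.Adj (b' j) (u j) := (C.Nb' j _).2 (Or.inl rfl)
  have bbj : b' j ≠ b i := by rw [hb]; exact (C.bb' j).symm
  by_cases hd : b' i = b' j
  · have t0 : pS G {u i} ≤ 5 := by
      simp [pS]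
    have t1 : pS G (insert (b i) {u i}) ≤ pS G {u i} + 1 :=
      pS_ins1 (n := u i) (by simpa using (nd (C.du i) (C.db i)).symm) (by simp) Ai
    have t2 : pS G (insert (b' i) (insert (b i) {u i})) ≤ pS G (insert (b i) {u i}) + 1 :=
      pS_ins1 (n := u i) (by simp [(C.bb' i).symm, (nd (C.du i) (C.db' i)).symm]) (by simp) Di
    have t3 : pS G (insert (u j) (insert (b' i) (insert (b i) {u i}))) ≤
        pS G (insert (b' i) (insert (b i) {u i})) - 3 :=
      pS_ins2 (n := b i) (n' := b' i)
        (by simp [uij.symm, nd (C.du j) (C.db' i), nd (C.du j) (C.db i)]) (C.bb' i) (by simp)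
        (by simp) Aj.symm (by rw [hd]; exact Dj.symm)
    refine lemA h (insert (u j) (insert (b' i) (insert (b i) {u i}))) ⟨u j, by simp⟩ (by linarith)
      v c1 (a 0) (a 1) ?_ avc (ava 0) (ava 1) (C.ca 0) (C.ca 1)
      (fun hh => absurd (C.ainj _ _ hh) (by decide))
    simp [C.vu, nd C.dv (C.db' i), nd C.dv (C.db i)]
  obtain ⟨k, hki, hkj, hall⟩ := third i j hne
  have w1u : w' i ≠ u j := by
    intro hh
    have h1 := (C.Nb' i (w' i)).2 (Or.inr rfl)
    rw [hh] at h1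
    have h2 := (C.Nu j _).1 h1.symm
    rcases h2 with h2 | h2 | h2
    · exact C'.ba _ _ h2
    · rw [← hb] at h2; exact C.bb' i h2.symm
    · exact hd h2
  have w2u : w' j ≠ u i := by
    intro hh
    have h1 := (C.Nb' j (w' j)).2 (Or.inr rfl)
    rw [hh] at h1
    have h2 := (C.Nu i _).1 h1.symm
    rcases h2 with h2 | h2 | h2
    · exact C'.ba _ _ h2
    · exact bbj h2
    · exact hd h2.symm
  obtain ⟨X, hX⟩ : ∃ X : V → Prop, ∀ z, X z ↔ z = v ∨ z = c1 ∨ z = c2 ∨ z = a i ∨ z = a j ∨ z = a k ∨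
    z = u i ∨ z = u j ∨ z = b i ∨ z = b' i ∨ z = b' j := ⟨fun z => _, fun z => Iff.rfl⟩
  obtain ⟨φ, hφ⟩ := exists_PC hc (Finset.univ.filter (fun z => ¬ X z)) (by
    intro hh
    have := Finset.mem_univ v
    rw [← hh] at this
    simp [hX] at this)
  obtain ⟨t, p, q, r1, r2, r3, r4, r5, r6, r7⟩ := coin_col (φ (w' i)) (φ (w' j)) (φ (u k)) (φ x)
  obtain ⟨e1, e2, he1, he2, he3⟩ := three_step t (φ x) r2
  obtain ⟨α3, ha3, ha3'⟩ := r1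
  obtain ⟨α1, ha1, ha1'⟩ := r3
  obtain ⟨α2, ha2, ha2'⟩ := r4
  obtain ⟨β, hβ, hβ'⟩ := r5
  obtain ⟨δ1, hδ1, hδ1'⟩ := r6
  obtain ⟨δ2, hδ2, hδ2'⟩ := r7
  have aij : a i ≠ a j := fun hh => hne (C.ainj _ _ hh)
  have aki : a k ≠ a i := fun hh => hki (C.ainj _ _ hh)
  have akj : a k ≠ a j := fun hh => hkj (C.ainj _ _ hh)
  have uki : u k ≠ u i := fun hh => hki (C.ui _ _ hh)
  have ukj : u k ≠ u j := fun hh => hkj (C.ui _ _ hh)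
  obtain ⟨ψ, hψ⟩ : ∃ ψ : V → Fin 5, ψ = fun z =>
    if z = v then t else if z = c1 then e1 else if z = c2 then e2 else
    if z = a i then α1 else if z = a j then α2 else if z = a k then α3 else
    if z = u i then p else if z = u j then q else if z = b i then β else
    if z = b' i then δ1 else if z = b' j then δ2 else φ z := ⟨_, rfl⟩
  have vc1 := (nd C.dv C.dc1).symm
  have vc2 := (nd C.dv C.dc2).symm
  have va := fun l => (nd C.dv (C.da l)).symm
  have vb := fun l => (nd C.dv (C.db l)).symm
  have vb' := fun l => (nd C.dv (C.db' l)).symm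
  have uc1 := fun l => (nd (C.du l) C.dc1)
  have uc2 := fun l => (nd (C.du l) C.dc2)
  have ua := fun l m => (nd (C.du l) (C.da m))
  have ub := fun l m => (nd (C.du l) (C.db m))
  have ub' := fun l m => (nd (C.du l) (C.db' m))
  have ev : ψ v = t := by simp [hψ]
  have ec1 : ψ c1 = e1 := by simp [hψ, vc1]
  have ec2 : ψ c2 = e2 := by simp [hψ, vc2, C.c12.symm]
  have eai : ψ (a i) = α1 := by simp [hψ, va, (C.ca _).symm, C.ac2]
  have eaj : ψ (a j) = α2 := by simp [hψ, va, (C.ca _).symm, C.ac2, aij.symm]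
  have eak : ψ (a k) = α3 := by simp [hψ, va, (C.ca _).symm, C.ac2, aki, akj]
  have eui : ψ (u i) = p := by simp [hψ, (C.vu _).symm, uc1, uc2, ua]
  have euj : ψ (u j) = q := by simp [hψ, (C.vu _).symm, uc1, uc2, ua, uij.symm]
  have eb : ψ (b i) = β := by
    simp [hψ, vb, C.bc1, C.bc2, C.ba, (ub _ _).symm]
  have edi : ψ (b' i) = δ1 := by
    simp [hψ, vb', C'.bc1, C'.bc2, C'.ba, (ub' _ _).symm, (C.bb' i).symm]
  have edj : ψ (b' j) = δ2 := by
    simp [hψ, vb', C'.bc1, C'.bc2, C'.ba, (ub' _ _).symm, bbj, Ne.symm hd]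
  have eφ : ∀ z, ¬ X z → ψ z = φ z := by
    intro z hz
    simp only [hX, not_or] at hz
    simp [hψ, hz]
  have xX : ¬ X x := by
    simp [hX, C.xv, C.xu, nd C.dx C.dc1, nd C.dx C.dc2, nd C.dx (C.da _), nd C.dx (C.db _), nd C.dx (C.db' _)]
  have ukX : ¬ X (u k) := by
    simp [hX, (C.vu _).symm, uc1, uc2, ua, uki, ukj, ub, ub']
  have w1X : ¬ X (w' i) := by
    simp [hX, C'.wv, C.wu', w1u, nd (C.dw' i) C.dc1, nd (C.dw' i) C.dc2, nd (C.dw' i) (C.da _), nd (C.dw' i) (C.db _), nd (C.dw' i) (C.db' _)]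
  have w2X : ¬ X (w' j) := by
    simp [hX, C'.wv, C.wu', w2u, nd (C.dw' j) C.dc1, nd (C.dw' j) C.dc2, nd (C.dw' j) (C.da _), nd (C.dw' j) (C.db _), nd (C.dw' j) (C.db' _)]
  have key : ∀ y z, X y → G.Adj y z → c5 (ψ y) (ψ z) := by
    intro y z hy hyz
    rw [hX] at hy
    rcases hy with rfl | rfl | rfl | rfl | rfl | rfl | rfl | rfl | rfl | rfl | rfl
    · rw [C.Nv] at hyz
      rcases hyz with rfl | ⟨l, rfl⟩
      · rw [ev, ec1]; exact he1
      · rcases hall l with rfl | rfl | rfl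
        · rw [ev, eai]; exact ha1
        · rw [ev, eaj]; exact ha2
        · rw [ev, eak]; exact ha3
    · rw [C.Nc1] at hyz
      rcases hyz with rfl | rfl
      · rw [ev, ec1]; exact he1.symm
      · rw [ec1, ec2]; exact he2
    · rw [C.Nc2] at hyz
      rcases hyz with rfl | rfl
      · rw [ec1, ec2]; exact he2.symm
      · rw [ec2, eφ _ xX]; exact he3
    · rw [C.Na] at hyz
      rcases hyz with rfl | rfl
      · rw [ev, eai]; exact ha1.symm
      · rw [eai, eui]; exact ha1'
    · rw [C.Na] at hyz
      rcases hyz with rfl | rfl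
      · rw [ev, eaj]; exact ha2.symm
      · rw [eaj, euj]; exact ha2'
    · rw [C.Na] at hyz
      rcases hyz with rfl | rfl
      · rw [ev, eak]; exact ha3.symm
      · rw [eak, eφ _ ukX]; exact ha3'
    · rw [C.Nu] at hyz
      rcases hyz with rfl | rfl | rfl
      · rw [eai, eui]; exact ha1'.symm
      · rw [eb, eui]; exact hβ
      · rw [edi, eui]; exact hδ1
    · rw [C.Nu] at hyz
      rcases hyz with rfl | rfl | rfl
      · rw [eaj, euj]; exact ha2'.symm
      · rw [← hb, eb, euj]; exact hβ'.symm
      · rw [edj, euj]; exact hδ2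
    · rw [C.Nb] at hyz
      rcases hyz with rfl | rfl
      · rw [eb, eui]; exact hβ.symm
      · rw [hw, eb, euj]; exact hβ'
    · rw [C.Nb'] at hyz
      rcases hyz with rfl | rfl
      · rw [edi, eui]; exact hδ1.symm
      · rw [edi, eφ _ w1X]; exact hδ1'
    · rw [C.Nb'] at hyz
      rcases hyz with rfl | rfl
      · rw [edj, euj]; exact hδ2.symm
      · rw [edj, eφ _ w2X]; exact hδ2'
  refine not_PC hc ψ ?_
  intro y z hyz
  by_cases hy : X y
  · exact key y z hy hyz
  by_cases hz : X z
  · exact (key z y hz hyz.symm).symm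
  rw [eφ y hy, eφ z hz]
  exact hφ y (by simp [hy]) z (by simp [hz]) hyz

lemma coin {V : Type} [Fintype V] {G : SimpleGraph V} (h : SmallestCex G)
    {v c1 c2 x : V} {u a b b' w w' : Fin 3 → V}
    (C : Cfg G v c1 c2 x u a b b' w w') (i j : Fin 3) (hw : w i = u j) : False := by
  have hne : i ≠ j := by rintro rfl; exact C.wu _ hw
  have h1 := (C.Nb i (w i)).2 (Or.inr rfl)
  rw [hw] at h1
  rcases (C.Nu j _).1 h1.symm with h2 | h2 | h2
  · exact C.ba _ _ h2
  · exact coin0 h C i j hne h2 hw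
  · exact coin0 h (C.swap (fun l => decide (l = j))) i j hne (by simp [hne, h2]) (by simp [hne, hw])

lemma noCfg {V : Type} [Fintype V] {G : SimpleGraph V} (h : SmallestCex G)
    {v c1 c2 x : V} {u a b b' w w' : Fin 3 → V}
    (C : Cfg G v c1 c2 x u a b b' w w') (hw : ∀ i, ¬ G.Adj (w i) (w' i)) : False := by
  have C' : Cfg G v c1 c2 x u a b' b w' w := by
    have := C.swap (fun _ => true)
    simpa using this
  exact noncoin h C (C.dist (fun i j hh => coin h C i j hh) (fun i j hh => coin h C' i j hh)) hw

end Pf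

namespace Pf
open scoped Classical

lemma str1 {V : Type} {G : SimpleGraph V} {v t : V} (p : G.Walk v t) (hp : IsString G p)
    (hl : p.length = 1 + 1) : G.Adj v (p.getVert 1) ∧ G.Adj (p.getVert 1) t ∧
      deg G (p.getVert 1) = 2 ∧ 3 ≤ deg G t ∧ t ≠ v := by
  obtain ⟨hpath, _, _, ht, hInt⟩ := hp
  match p, hl with
  | Walk.cons h1 (Walk.cons h2 Walk.nil), _ =>
    simp [Walk.cons_isPath_iff] at hpath hInt ⊢
    refine ⟨h1, h2, hInt h1.ne' h2.ne, ht, fun h => hpath.2.2 h.symm⟩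

lemma str2 {V : Type} {G : SimpleGraph V} {v t : V} (p : G.Walk v t) (hp : IsString G p)
    (hl : p.length = 2 + 1) : ∃ c2, G.Adj v (p.getVert 1) ∧ G.Adj (p.getVert 1) c2 ∧ G.Adj c2 t ∧
      deg G (p.getVert 1) = 2 ∧ deg G c2 = 2 ∧ 3 ≤ deg G t ∧ t ≠ v ∧ c2 ≠ v ∧ p.getVert 1 ≠ t := by
  obtain ⟨hpath, _, _, ht, hInt⟩ := hp
  match p, hl with
  | Walk.cons h1 (Walk.cons (v := c2) h2 (Walk.cons h3 Walk.nil)), _ =>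
    refine ⟨c2, ?_⟩
    simp [Walk.cons_isPath_iff] at hpath hInt ⊢
    grind [SimpleGraph.Adj.ne]

lemma end2 {V : Type} {G : SimpleGraph V} {v a t y : V} (p : G.Walk v y) (hp : IsString G p)
    (ha : p.getVert 1 = a) (hd : deg G a = 2) (hN : ∀ n, G.Adj a n ↔ n = v ∨ n = t)
    (ht : 3 ≤ deg G t) : y = t := by
  obtain ⟨hpath, hl, _, hy, hInt⟩ := hp
  match p with
  | Walk.nil => simp at hl
  | Walk.cons h1 Walk.nil => simp at ha; subst ha; omega
  | Walk.cons h1 (Walk.cons (v := s) h2 q) =>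
    simp at ha
    subst ha
    simp [Walk.cons_isPath_iff] at hpath hInt
    rw [hN] at h2
    have hsq : s ∈ q.support := q.start_mem_support
    rcases h2 with rfl | rfl
    · exact absurd hsq hpath.2.2
    · by_contra hne
      have := hInt.2 s hsq (fun hh => hpath.2.2 (hh ▸ hsq)) (Ne.symm hne)
      omega

lemma end3 {V : Type} {G : SimpleGraph V} {v a c t y : V} (p : G.Walk v y) (hp : IsString G p)
    (ha : p.getVert 1 = a) (hd : deg G a = 2) (hN : ∀ n, G.Adj a n ↔ n = v ∨ n = c)
    (hd2 : deg G c = 2) (hN2 : ∀ n, G.Adj c n ↔ n = a ∨ n = t)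
    (ht : 3 ≤ deg G t) : y = t := by
  obtain ⟨hpath, hl, _, hy, hInt⟩ := hp
  match p with
  | Walk.nil => simp at hl
  | Walk.cons h1 Walk.nil => simp at ha; subst ha; omega
  | Walk.cons h1 (Walk.cons h2 Walk.nil) =>
    simp at ha
    subst ha
    simp [Walk.cons_isPath_iff] at hpath hInt
    rw [hN] at h2
    rcases h2 with rfl | rfl
    · simp at hpath
    · omega
  | Walk.cons (v := a') h1 (Walk.cons (v := s) h2 (Walk.cons (v := r) h3 q)) =>
    simp at ha
    subst ha
    simp [Walk.cons_isPath_iff] at hpath hInt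
    rw [hN] at h2
    have hsq : r ∈ q.support := q.start_mem_support
    rcases h2 with rfl | rfl
    · simp at hpath
    · rw [hN2] at h3
      rcases h3 with rfl | rfl
      · exact absurd hsq hpath.1.2.2
      · by_contra hne
        have := hInt.2.2 r hsq (fun hh => hpath.2.2.2 (hh ▸ hsq)) (Ne.symm hne)
        omega

lemma N2 {V : Type} [Fintype V] {G : SimpleGraph V} {a p q : V} (hd : deg G a = 2) (h1 : G.Adj a p)
    (h2 : G.Adj a q) (hne : p ≠ q) (n : V) : G.Adj a n ↔ n = p ∨ n = q := by
  have : ({p, q} : Set V) = G.neighborSet a := by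
    refine Set.eq_of_subset_of_ncard_le ?_ ?_ (Set.toFinite _)
    · intro z; simp; rintro (rfl | rfl) <;> assumption
    · rw [Set.ncard_pair hne]; exact hd.le
  rw [← mem_neighborSet, ← this]; simp

lemma N3 {V : Type} [Fintype V] {G : SimpleGraph V} {a p q r : V} (hd : deg G a = 3) (h1 : G.Adj a p)
    (h2 : G.Adj a q) (h3 : G.Adj a r) (hpq : p ≠ q) (hpr : p ≠ r) (hqr : q ≠ r) (n : V) :
    G.Adj a n ↔ n = p ∨ n = q ∨ n = r := by
  have : ({p, q, r} : Set V) = G.neighborSet a := by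
    refine Set.eq_of_subset_of_ncard_le ?_ ?_ (Set.toFinite _)
    · intro z; simp; rintro (rfl | rfl | rfl) <;> assumption
    · rw [Set.ncard_eq_three.2 ⟨p, q, r, hpq, hpr, hqr, rfl⟩]; exact hd.le
  rw [← mem_neighborSet, ← this]; simp

lemma N4 {V : Type} [Fintype V] {G : SimpleGraph V} {v p q r s : V} (hd : deg G v = 4)
    (h1 : G.Adj v p) (h2 : G.Adj v q) (h3 : G.Adj v r) (h4 : G.Adj v s) (hpq : p ≠ q) (hpr : p ≠ r)
    (hps : p ≠ s) (hqr : q ≠ r) (hqs : q ≠ s) (hrs : r ≠ s) (n : V) :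
    G.Adj v n ↔ n = p ∨ n = q ∨ n = r ∨ n = s := by
  have : ({p, q, r, s} : Set V) = G.neighborSet v := by
    refine Set.eq_of_subset_of_ncard_le ?_ ?_ (Set.toFinite _)
    · intro z; simp; rintro (rfl | rfl | rfl | rfl) <;> assumption
    · rw [Set.ncard_insert_of_notMem (by simp [hpq, hpr, hps]),
        Set.ncard_eq_three.2 ⟨q, r, s, hqr, hqs, hrs, rfl⟩]; exact hd.le
  rw [← mem_neighborSet, ← this]; simp

/-- the neighbours of a special vertex -/
lemma v3 {V : Type} [Fintype V] {G : SimpleGraph V} {y : V} (h : IsVertex3 G y 1 1 1) (a : V)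
    (ha : G.Adj y a) : ∃ b b' w0 w w', (∀ n, G.Adj y n ↔ n = a ∨ n = b ∨ n = b') ∧ a ≠ b ∧ a ≠ b' ∧
      b ≠ b' ∧ (∀ n, G.Adj a n ↔ n = y ∨ n = w0) ∧
      (∀ n, G.Adj b n ↔ n = y ∨ n = w) ∧ (∀ n, G.Adj b' n ↔ n = y ∨ n = w') ∧
      3 ≤ deg G w0 ∧ 3 ≤ deg G w ∧ 3 ≤ deg G w' ∧ w0 ≠ y ∧ w ≠ y ∧ w' ≠ y ∧
      deg G b = 2 ∧ deg G b' = 2 := by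
  obtain ⟨hd, u1, u2, u3, p1, p2, p3, s1, s2, s3, h12, h13, h23, l1, l2, l3⟩ := h
  obtain ⟨A1, B1, D1, E1, F1⟩ := str1 p1 s1 l1
  obtain ⟨A2, B2, D2, E2, F2⟩ := str1 p2 s2 l2
  obtain ⟨A3, B3, D3, E3, F3⟩ := str1 p3 s3 l3
  have hN := N3 hd A1 A2 A3 h12 h13 h23
  have M1 := N2 D1 A1.symm B1 F1.symm
  have M2 := N2 D2 A2.symm B2 F2.symm
  have M3 := N2 D3 A3.symm B3 F3.symm
  rcases (hN a).1 ha with rfl | rfl | rfl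
  · exact ⟨_, _, u1, u2, u3, hN, h12, h13, h23, M1, M2, M3, E1, E2, E3, F1, F2, F3, D2, D3⟩
  · exact ⟨_, _, u2, u1, u3, fun n => by rw [hN]; tauto, h12.symm, h23, h13, M2, M1, M3, E2, E1, E3, F2, F1, F3, D1, D3⟩
  · exact ⟨_, _, u3, u1, u2, fun n => by rw [hN]; tauto, h13.symm, h23.symm, h12, M3, M1, M2, E3, E1, E2, F3, F1, F2, D1, D2⟩

lemma fiveC {V : Type} {G : SimpleGraph V} {y b w w' b' : V} (h1 : G.Adj y b) (h2 : G.Adj b w)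
    (h3 : G.Adj w w') (h4 : G.Adj w' b') (h5 : G.Adj b' y) (a1 : b ≠ b') (a2 : b ≠ w') (a3 : w ≠ b')
    (a4 : w ≠ y) (a5 : w' ≠ y) : InFiveCycle G y := by
  refine ⟨y, Walk.cons h1 (Walk.cons h2 (Walk.cons h3 (Walk.cons h4 (Walk.cons h5 Walk.nil)))), ?_, rfl, by simp⟩
  rw [Walk.cons_isCycle_iff]
  simp [Walk.cons_isPath_iff]
  grind [SimpleGraph.Adj.ne]

lemma main {V : Type} [Fintype V] (G : SimpleGraph V)
    (h : SmallestCex G) (v : V)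
    (hv : IsVertex4 G v 2 1 1 1) :
    {u : V | (∃ p : G.Walk v u, IsString G p) ∧ IsVertex3 G u 1 1 1 ∧
      ¬ InFiveCycle G u}.ncard ≤ 2 := by
  obtain ⟨hd, x, t1, t2, t3, p0, p1, p2, p3, s0, s1, s2, s3, n01, n02, n03, n12, n13, n23, l0, l1, l2, l3⟩ := hv
  obtain ⟨c2, A0, A0', A0'', D0, D0', E0, F0, F0', F0''⟩ := str2 p0 s0 l0
  obtain ⟨A1, B1, D1, E1, F1⟩ := str1 p1 s1 l1
  obtain ⟨A2, B2, D2, E2, F2⟩ := str1 p2 s2 l2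
  obtain ⟨A3, B3, D3, E3, F3⟩ := str1 p3 s3 l3
  have Nv := N4 hd A0 A1 A2 A3 n01 n02 n03 n12 n13 n23
  have Nc1 := N2 D0 A0.symm A0' F0'.symm
  have Nc2 := N2 D0' A0'.symm A0'' F0''
  have Na1 := N2 D1 A1.symm B1 F1.symm
  have Na2 := N2 D2 A2.symm B2 F2.symm
  have Na3 := N2 D3 A3.symm B3 F3.symm
  have hx : ¬ IsVertex3 G x 1 1 1 := by
    intro hx
    obtain ⟨b, b', w0, w, w', _, _, _, _, H, _, _, H2, _, _, H3, _⟩ := v3 hx c2 A0''.symm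
    have := (H w0).2 (Or.inr rfl)
    rw [Nc2] at this
    rcases this with rfl | rfl
    · omega
    · exact H3 rfl
  obtain ⟨A, hA⟩ : ∃ A, A = {u : V | (∃ p : G.Walk v u, IsString G p) ∧ IsVertex3 G u 1 1 1 ∧
      ¬ InFiveCycle G u} := ⟨_, rfl⟩
  rw [← hA]
  by_contra hcard
  let t : Fin 3 → V := ![t1, t2, t3]
  let a : Fin 3 → V := ![p1.getVert 1, p2.getVert 1, p3.getVert 1]
  have hsub : A ⊆ ((Finset.univ.image t : Finset V) : Set V) := by
    intro y hy
    rw [hA] at hy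
    obtain ⟨⟨p, hp⟩, hy3, _⟩ := hy
    have hadj : G.Adj v (p.getVert 1) := by
      have := p.adj_getVert_succ (i := 0) hp.2.1
      simpa using this
    rw [Nv] at hadj
    simp only [Finset.coe_image, Finset.coe_univ, Set.image_univ, Set.mem_range]
    rcases hadj with e | e | e | e
    · have := end3 p hp e D0 Nc1 D0' Nc2 E0
      subst this
      exact absurd hy3 hx
    · exact ⟨0, (end2 p hp e D1 Na1 E1).symm⟩
    · exact ⟨1, (end2 p hp e D2 Na2 E2).symm⟩
    · exact ⟨2, (end2 p hp e D3 Na3 E3).symm⟩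
  have hle := Set.ncard_le_ncard hsub (Set.toFinite _)
  rw [Set.ncard_coe_finset] at hle
  have hle3 : (Finset.univ.image t).card ≤ 3 := Finset.card_image_le
  have heq : A = ((Finset.univ.image t : Finset V) : Set V) := by
    apply Set.eq_of_subset_of_ncard_le hsub
    rw [Set.ncard_coe_finset]; omega
  have htinj : Function.Injective t := by
    have : (Finset.univ.image t).card = (Finset.univ : Finset (Fin 3)).card := by simp; omega
    rw [Finset.card_image_iff] at this
    simpa using this
  have htA : ∀ i, IsVertex3 G (t i) 1 1 1 ∧ ¬ InFiveCycle G (t i) := by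
    intro i
    have : t i ∈ A := by rw [heq]; simp
    rw [hA] at this
    exact this.2
  have fall : ∀ (P : Fin 3 → Prop), P 0 → P 1 → P 2 → ∀ i, P i := by
    intro P h0 h1 h2 i; fin_cases i <;> assumption
  have Na : ∀ i n, G.Adj (a i) n ↔ n = v ∨ n = t i := fall _ Na1 Na2 Na3
  have hta : ∀ i, G.Adj (t i) (a i) := fun i => ((Na i _).2 (Or.inr rfl)).symm
  choose b b' w0 w w' Nu ab ab' bb' _ Nb Nb' _ dw dw' _ wy wy' db db' using
    fun i => v3 (htA i).1 (a i) (hta i)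
  have nd : ∀ {p q : V}, 3 ≤ deg G p → deg G q = 2 → p ≠ q := fun h1 h2 => Cfg.ne_of_deg h1 h2
  have C : Cfg G v (p0.getVert 1) c2 x t a b b' w w' := by
    refine ⟨?_, Nc1, Nc2, Na, Nu, Nb, Nb', fun i j hh => htinj hh, fall _ n01 n02 n03, ab, ab', bb',
      wy, wy', ?_, F0, fall _ F1.symm F2.symm F3.symm, by omega, E0, fall _ E1 E2 E3, dw, dw', D0, D0',
      fall _ D1 D2 D3, db, db'⟩
    · intro n
      rw [Nv, ex3]; rfl
    · intro i hh
      rw [hh] at hx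
      exact hx (htA i).1
  refine noCfg h C ?_
  intro i hadj
  refine (htA i).2 (fiveC (b := b i) (w := w i) (w' := w' i) (b' := b' i) ?_ ?_ hadj ?_ ?_ (bb' i)
    (nd (dw' i) (db i)).symm (nd (dw i) (db' i)) (wy i) (wy' i))
  · exact ((Nb i _).2 (Or.inl rfl)).symm
  · exact (Nb i _).2 (Or.inr rfl)
  · exact ((Nb' i _).2 (Or.inr rfl)).symm
  · exact (Nb' i _).2 (Or.inl rfl)

end Pf

/-- Let `v` be a `(2,1,1,1)`-vertex of a smallest counterexample that is
not contained in any 5-cycle. Then `v` has at most two friends that are `(1,1,1)`-vertices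
not contained in any 5-cycle. -/
theorem smallestCex_at_most_two_special_friends {V : Type} [Fintype V] (G : SimpleGraph V)
    (h : SmallestCex G) (v : V)
    (hv : IsVertex4 G v 2 1 1 1)
    (hnc : ¬ InFiveCycle G v) :
    {u : V | (∃ p : G.Walk v u, IsString G p) ∧ IsVertex3 G u 1 1 1 ∧
      ¬ InFiveCycle G u}.ncard ≤ 2 := by
  exact Pf.main G h v hv
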